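/- Let n ≥ 1 and let Λ, Λ' ∈ M_n(k*) be multiplicatively antisymmetric. Suppose the quantum torus O_Λ((k*)^n) is a simple ring. Let (D, ι) be a division ring of fractions of S_{n,n}^Λ(k) and (D', ι') a division ring of fractions of S_{n,n}^{Λ'}(k). Then D and D' are isomorphic as k-algebras if and only if the quantum tori O_Λ((k*)^n) and O_{Λ'}((k*)^n) are isomorphic as k-algebras. -/

import Mathlib

universe u

/-- A matrix is multiplicatively antisymmetric if `Λ i i = 1` and `Λ i j * Λ j i = 1`
for all `i, j`. -/
def Matrix.MulAntisymmetric {k : Type u} [Field k] {n : ℕ}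
    (Λ : Matrix (Fin n) (Fin n) k) : Prop :=
  (∀ i, Λ i i = 1) ∧ ∀ i j, Λ i j * Λ j i = 1

inductive QTorusRel (k : Type u) [Field k] {n : ℕ} (Λ : Matrix (Fin n) (Fin n) k) :
    FreeAlgebra k (Fin n ⊕ Fin n) → FreeAlgebra k (Fin n ⊕ Fin n) → Prop
  | comm (i j : Fin n) :
      QTorusRel k Λ (FreeAlgebra.ι k (Sum.inl i) * FreeAlgebra.ι k (Sum.inl j))
        (algebraMap k _ (Λ i j) * (FreeAlgebra.ι k (Sum.inl j) * FreeAlgebra.ι k (Sum.inl i)))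
  | mul_inv (i : Fin n) :
      QTorusRel k Λ (FreeAlgebra.ι k (Sum.inl i) * FreeAlgebra.ι k (Sum.inr i)) 1
  | inv_mul (i : Fin n) :
      QTorusRel k Λ (FreeAlgebra.ι k (Sum.inr i) * FreeAlgebra.ι k (Sum.inl i)) 1

/-- The quantum torus `O_Λ((k*)^n)`. -/
def QuantumTorus (k : Type u) [Field k] {n : ℕ} (Λ : Matrix (Fin n) (Fin n) k) :=
  RingQuot (QTorusRel k Λ)

noncomputable instance (k : Type u) [Field k] {n : ℕ} (Λ : Matrix (Fin n) (Fin n) k) :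
    Ring (QuantumTorus k Λ) := by unfold QuantumTorus; infer_instance

noncomputable instance (k : Type u) [Field k] {n : ℕ} (Λ : Matrix (Fin n) (Fin n) k) :
    Algebra k (QuantumTorus k Λ) := by unfold QuantumTorus; infer_instance

/-- The generator `y_i` of the quantum torus. -/
noncomputable def QuantumTorus.y (k : Type u) [Field k] {n : ℕ}
    (Λ : Matrix (Fin n) (Fin n) k) (i : Fin n) : QuantumTorus k Λ :=
  RingQuot.mkAlgHom k (QTorusRel k Λ) (FreeAlgebra.ι k (Sum.inl i))

/-- The generator `y_i⁻¹` of the quantum torus. -/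
noncomputable def QuantumTorus.yinv (k : Type u) [Field k] {n : ℕ}
    (Λ : Matrix (Fin n) (Fin n) k) (i : Fin n) : QuantumTorus k Λ :=
  RingQuot.mkAlgHom k (QTorusRel k Λ) (FreeAlgebra.ι k (Sum.inr i))


inductive MixedCrossedRel (k : Type u) [Field k] {n : ℕ} (Λ : Matrix (Fin n) (Fin n) k)
    (r : ℕ) (hr : r ≤ n) :
    FreeAlgebra k (Fin n ⊕ Fin r) → FreeAlgebra k (Fin n ⊕ Fin r) → Prop
  | yy (i j : Fin n) :
      MixedCrossedRel k Λ r hr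
        (FreeAlgebra.ι k (Sum.inl i) * FreeAlgebra.ι k (Sum.inl j))
        (algebraMap k _ (Λ i j) * (FreeAlgebra.ι k (Sum.inl j) * FreeAlgebra.ι k (Sum.inl i)))
  | xy_same (i : Fin r) :
      MixedCrossedRel k Λ r hr
        (FreeAlgebra.ι k (Sum.inr i) * FreeAlgebra.ι k (Sum.inl (Fin.castLE hr i)))
        (FreeAlgebra.ι k (Sum.inl (Fin.castLE hr i)) * FreeAlgebra.ι k (Sum.inr i) + 1)
  | xy_ne (i : Fin r) (j : Fin n) (hij : Fin.castLE hr i ≠ j) :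
      MixedCrossedRel k Λ r hr
        (FreeAlgebra.ι k (Sum.inr i) * FreeAlgebra.ι k (Sum.inl j))
        (algebraMap k _ (Λ (Fin.castLE hr i) j)⁻¹ *
          (FreeAlgebra.ι k (Sum.inl j) * FreeAlgebra.ι k (Sum.inr i)))
  | xx (i j : Fin r) :
      MixedCrossedRel k Λ r hr
        (FreeAlgebra.ι k (Sum.inr i) * FreeAlgebra.ι k (Sum.inr j))
        (algebraMap k _ (Λ (Fin.castLE hr i) (Fin.castLE hr j)) *
          (FreeAlgebra.ι k (Sum.inr j) * FreeAlgebra.ι k (Sum.inr i)))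

/-- The mixed crossed polynomial algebra `S_{n,r}^Λ(k)`. -/
def MixedCrossedAlgebra (k : Type u) [Field k] {n : ℕ} (Λ : Matrix (Fin n) (Fin n) k)
    (r : ℕ) (hr : r ≤ n) :=
  RingQuot (MixedCrossedRel k Λ r hr)

noncomputable instance (k : Type u) [Field k] {n : ℕ} (Λ : Matrix (Fin n) (Fin n) k)
    (r : ℕ) (hr : r ≤ n) : Ring (MixedCrossedAlgebra k Λ r hr) := by
  unfold MixedCrossedAlgebra; infer_instance

noncomputable instance (k : Type u) [Field k] {n : ℕ} (Λ : Matrix (Fin n) (Fin n) k)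
    (r : ℕ) (hr : r ≤ n) : Algebra k (MixedCrossedAlgebra k Λ r hr) := by
  unfold MixedCrossedAlgebra; infer_instance

/-- The generator `y_j` of `S_{n,r}^Λ(k)`. -/
noncomputable def MixedCrossedAlgebra.y (k : Type u) [Field k] {n : ℕ}
    (Λ : Matrix (Fin n) (Fin n) k) (r : ℕ) (hr : r ≤ n) (j : Fin n) :
    MixedCrossedAlgebra k Λ r hr :=
  RingQuot.mkAlgHom k (MixedCrossedRel k Λ r hr) (FreeAlgebra.ι k (Sum.inl j))

/-- The generator `x_i` of `S_{n,r}^Λ(k)`. -/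
noncomputable def MixedCrossedAlgebra.x (k : Type u) [Field k] {n : ℕ}
    (Λ : Matrix (Fin n) (Fin n) k) (r : ℕ) (hr : r ≤ n) (i : Fin r) :
    MixedCrossedAlgebra k Λ r hr :=
  RingQuot.mkAlgHom k (MixedCrossedRel k Λ r hr) (FreeAlgebra.ι k (Sum.inr i))


structure FractionDivisionRing (k : Type u) [Field k] (A : Type u) [Ring A] [Algebra k A] where
  carrier : Type u
  [divisionRing : DivisionRing carrier]
  [algebra : Algebra k carrier]
  emb : A →ₐ[k] carrier
  emb_injective : Function.Injective emb
  frac : ∀ d : carrier, ∃ a b : A, b ≠ 0 ∧ d = emb a * (emb b)⁻¹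

attribute [instance] FractionDivisionRing.divisionRing FractionDivisionRing.algebra

section Bicharacter

variable {G : Type*} [CommGroup G] {n : ℕ}

/-- The bicharacter of `ℤⁿ` with values `L i j` on the standard basis. -/
def bicharacter (L : Fin n → Fin n → G) (a b : Fin n → ℤ) : G :=
  ∏ i, ∏ j, L i j ^ (a i * b j)

theorem bicharacter_add_left (L : Fin n → Fin n → G) (a b c : Fin n → ℤ) :
    bicharacter L (a + b) c = bicharacter L a c * bicharacter L b c := by
  simp [bicharacter, add_mul, zpow_add, Finset.prod_mul_distrib]

theorem bicharacter_add_right (L : Fin n → Fin n → G) (a b c : Fin n → ℤ) :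
    bicharacter L a (b + c) = bicharacter L a b * bicharacter L a c := by
  simp [bicharacter, mul_add, zpow_add, Finset.prod_mul_distrib]

theorem bicharacter_neg_left (L : Fin n → Fin n → G) (a b : Fin n → ℤ) :
    bicharacter L (-a) b = (bicharacter L a b)⁻¹ := by
  simp [bicharacter]

theorem bicharacter_neg_right (L : Fin n → Fin n → G) (a b : Fin n → ℤ) :
    bicharacter L a (-b) = (bicharacter L a b)⁻¹ := by
  simp [bicharacter]

@[simp]
theorem bicharacter_zero_left (L : Fin n → Fin n → G) (b : Fin n → ℤ) :
    bicharacter L 0 b = 1 := by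
  simp [bicharacter]

@[simp]
theorem bicharacter_zero_right (L : Fin n → Fin n → G) (a : Fin n → ℤ) :
    bicharacter L a 0 = 1 := by
  simp [bicharacter]

@[simp]
theorem bicharacter_single_single (L : Fin n → Fin n → G) (i j : Fin n) :
    bicharacter L (Pi.single i 1) (Pi.single j 1) = L i j := by
  unfold bicharacter
  rw [Finset.prod_eq_single i, Finset.prod_eq_single j]
  · simp
  · intro b _ hb; simp [hb]
  · simp
  · intro b _ hb; simp [hb]
  · simp

/-- A bicharacter as a `ℤ`-bilinear form with values in `Additive G`. -/
def bicharacterForm (L : Fin n → Fin n → G) :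
    (Fin n → ℤ) →ₗ[ℤ] (Fin n → ℤ) →ₗ[ℤ] Additive G :=
  AddMonoidHom.toIntLinearMap (AddMonoidHom.mk'
    (fun a => AddMonoidHom.toIntLinearMap (AddMonoidHom.mk'
      (fun b => Additive.ofMul (bicharacter L a b))
      (fun b c => by rw [bicharacter_add_right, ofMul_mul])))
    (fun a b => by
      ext c
      simp [bicharacter_add_left]))

theorem bicharacterForm_apply (L : Fin n → Fin n → G) (a b : Fin n → ℤ) :
    bicharacterForm L a b = Additive.ofMul (bicharacter L a b) := rfl

/-- The pullback of a bicharacter along an integer matrix. -/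
theorem bicharacter_vecMul {L L' : Fin n → Fin n → G} {M : Matrix (Fin n) (Fin n) ℤ}
    (h : ∀ i j, L' i j = bicharacter L (M i) (M j)) (a b : Fin n → ℤ) :
    bicharacter L' a b = bicharacter L (Matrix.vecMul a M) (Matrix.vecMul b M) := by
  suffices H : bicharacterForm L' =
      (bicharacterForm L).compl₁₂ (Matrix.vecMulLinear M) (Matrix.vecMulLinear M) from
    congrArg (fun B => Additive.toMul (B a b)) H
  refine LinearMap.ext_basis (Pi.basisFun ℤ (Fin n)) (Pi.basisFun ℤ (Fin n)) fun i j => ?_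
  simp [bicharacterForm_apply, h, Matrix.row]

end Bicharacter

/-- An endomorphism of a finite free module preserving a nondegenerate
bilinear form (with values in an arbitrary module) is invertible. -/
theorem LinearMap.isUnit_of_preserves_separating {R V A : Type*} [CommRing R] [AddCommGroup V]
    [Module R V] [Module.Free R V] [Module.Finite R V] [AddCommGroup A] [Module R A]
    (B : V →ₗ[R] V →ₗ[R] A) (hB : ∀ a, (∀ b, B a b = 0) → a = 0)
    (f : Module.End R V) (hf : ∀ a b, B (f a) (f b) = B a b) : IsUnit f := by
  set p := f.charpoly with hp
  have hpow : ∀ i a b, B ((f ^ i) a) ((f ^ i) b) = B a b := by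
    intro i
    induction i with
    | zero => simp
    | succ i ih => intro a b; rw [pow_succ', Module.End.mul_apply, Module.End.mul_apply, hf, ih]
  have h0 : ∑ i ∈ Finset.range (p.natDegree + 1), p.coeff i • f ^ i = 0 := by
    rw [← Polynomial.aeval_eq_sum_range, hp, LinearMap.aeval_self_charpoly]
  have h1 : ∑ i ∈ Finset.range (p.natDegree + 1), p.coeff i • f ^ (p.natDegree - i) = 0 := by
    ext a
    refine hB _ fun b => ?_
    have h2 : B ((f ^ p.natDegree) a)
        ((∑ i ∈ Finset.range (p.natDegree + 1), p.coeff i • f ^ i) b) = 0 := by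
      rw [h0]; simp
    rw [← h2]
    simp only [LinearMap.sum_apply, map_sum, LinearMap.smul_apply, map_smul]
    refine Finset.sum_congr rfl fun i hi => ?_
    have hi' : p.natDegree = i + (p.natDegree - i) := by
      have := Finset.mem_range.1 hi; omega
    conv_rhs => rw [hi', pow_add, Module.End.mul_apply, hpow]
  rw [Finset.sum_range_succ, Nat.sub_self, pow_zero, Polynomial.coeff_natDegree,
    (LinearMap.charpoly_monic f).leadingCoeff, one_smul] at h1
  have h3 : ∑ i ∈ Finset.range p.natDegree, p.coeff i • f ^ (p.natDegree - i) =
      f * ∑ i ∈ Finset.range p.natDegree, p.coeff i • f ^ (p.natDegree - i - 1) := by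
    rw [Finset.mul_sum]
    refine Finset.sum_congr rfl fun i hi => ?_
    have hi' : p.natDegree - i = (p.natDegree - i - 1) + 1 := by
      have := Finset.mem_range.1 hi; omega
    rw [mul_smul_comm, ← pow_succ', ← hi']
  have h4 : f * (-∑ i ∈ Finset.range p.natDegree, p.coeff i • f ^ (p.natDegree - i - 1)) = 1 := by
    rw [mul_neg, ← h3, eq_comm, ← add_eq_zero_iff_eq_neg, add_comm]
    exact h1
  refine ⟨⟨f, _, h4, ?_⟩, rfl⟩
  rw [← h4]
  exact ((Commute.sum_right _ _ _ fun i _ => ((Commute.refl f).pow_right _).smul_right _).neg_right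
    ).eq.symm

/-- Two bicharacters that are pullbacks of each other, one of them nondegenerate, are pullbacks
of each other along invertible matrices. -/
theorem isUnit_of_bicharacter_pullback {G : Type*} [CommGroup G] {n : ℕ}
    {L L' : Fin n → Fin n → G} (hL : ∀ a, (∀ b, bicharacter L a b = 1) → a = 0)
    {M N : Matrix (Fin n) (Fin n) ℤ}
    (hM : ∀ i j, L' i j = bicharacter L (M i) (M j))
    (hN : ∀ i j, L i j = bicharacter L' (N i) (N j)) : IsUnit M ∧ IsUnit N := by
  have h : IsUnit (Matrix.vecMulLinear (N * M)) := by
    refine LinearMap.isUnit_of_preserves_separating (bicharacterForm L)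
      (fun a ha => hL a fun b => ?_) _ fun a b => ?_
    · exact Additive.ofMul.injective (ha b)
    · rw [bicharacterForm_apply, bicharacterForm_apply, bicharacter_vecMul hN a b,
        bicharacter_vecMul hM]
      simp [Matrix.vecMul_vecMul]
  have h' : IsUnit (N * M) := by
    rw [← Matrix.vecMul_surjective_iff_isUnit]
    intro b
    obtain ⟨g, hg⟩ := h.exists_right_inv
    exact ⟨g b, LinearMap.congr_fun hg b⟩
  rw [Matrix.isUnit_iff_isUnit_det, Matrix.det_mul, IsUnit.mul_iff] at h'
  rw [Matrix.isUnit_iff_isUnit_det, Matrix.isUnit_iff_isUnit_det]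
  exact h'.symm

section Monomials

variable {k : Type*} [Field k] {R : Type*} [Ring R] [Algebra k R] {n : ℕ}

/-- Invertible scalars as units of an algebra. -/
abbrev unitScalar (k : Type*) [Field k] (R : Type*) [Ring R] [Algebra k R] : kˣ →* Rˣ :=
  Units.map (algebraMap k R : k →* R)

theorem unitScalar_mul_comm (c : kˣ) (u : Rˣ) : unitScalar k R c * u = u * unitScalar k R c :=
  Units.ext (Algebra.commutes (c : k) (u : R))

theorem Pi.int_induction {P : (Fin n → ℤ) → Prop} (h0 : P 0) (h1 : ∀ i, P (Pi.single i 1))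
    (hadd : ∀ a b, P a → P b → P (a + b)) (hneg : ∀ a, P a → P (-a)) (a : Fin n → ℤ) : P a := by
  have hs : ∀ i (z : ℤ), P (Pi.single i z) := by
    intro i z
    induction z with
    | zero => simpa using h0
    | succ z ih => rw [Pi.single_add]; exact hadd _ _ ih (h1 i)
    | pred z ih =>
      have h : (Pi.single i (-1) : Fin n → ℤ) = -Pi.single i 1 :=
        map_neg (AddMonoidHom.single (fun _ : Fin n => ℤ) i) 1
      rw [sub_eq_add_neg, Pi.single_add, h]
      exact hadd _ _ ih (hneg _ (h1 i))
  rw [← Finset.univ_sum_single a]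
  exact Finset.sum_induction _ P hadd h0 fun i _ => hs i (a i)

/-- Laurent monomials in units commuting up to scalars, with the induction principle
determining them up to scalars. -/
theorem exists_monomials (y : Fin n → Rˣ) (L : Fin n → Fin n → kˣ)
    (hy : ∀ i j, y i * y j = unitScalar k R (L i j) * (y j * y i)) :
    ∃ Y : (Fin n → ℤ) → Rˣ,
      (∀ a b, ∃ c : kˣ, Y a * Y b = unitScalar k R c * Y (a + b)) ∧
      (∀ i, ∃ c : kˣ, Y (Pi.single i 1) = unitScalar k R c * y i) ∧
      ∀ Q : (Fin n → ℤ) → Rˣ → Prop, (∀ c, Q 0 (unitScalar k R c)) →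
        (∀ i, Q (Pi.single i 1) (y i)) → (∀ a b u v, Q a u → Q b v → Q (a + b) (u * v)) →
        (∀ a u, Q a u → Q (-a) u⁻¹) → ∀ a, Q a (Y a) := by
  set Z : Subgroup Rˣ := (unitScalar k R).range with hZ
  have hZn : Z.Normal := ⟨by
    rintro _ ⟨c, rfl⟩ g
    exact ⟨c, by rw [← unitScalar_mul_comm, mul_inv_cancel_right]⟩⟩
  have hmk : ∀ u v : Rˣ, (u : Rˣ ⧸ Z) = v → ∃ c, u = unitScalar k R c * v := by
    intro u v h
    obtain ⟨c, hc⟩ := QuotientGroup.eq.1 h.symm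
    exact ⟨c, by rw [unitScalar_mul_comm, hc, mul_inv_cancel_left]⟩
  have hcomm : ∀ i j, Commute (y i : Rˣ ⧸ Z) (y j) := by
    intro i j
    refine QuotientGroup.eq.2 ⟨(L i j)⁻¹, ?_⟩
    rw [eq_inv_mul_iff_mul_eq]
    change y i * y j * _ = y j * y i
    rw [hy i j, unitScalar_mul_comm, mul_assoc, ← map_mul, mul_inv_cancel, map_one, mul_one]
  have hcomm' : Pairwise fun i j => ∀ a b : Multiplicative ℤ,
      Commute (zpowersHom (Rˣ ⧸ Z) (y i : Rˣ ⧸ Z) a) (zpowersHom (Rˣ ⧸ Z) (y j : Rˣ ⧸ Z) b) := by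
    intro i j _ a b
    rw [zpowersHom_apply, zpowersHom_apply]
    exact (hcomm i j).zpow_zpow _ _
  let π := MonoidHom.noncommPiCoprod (fun i => zpowersHom (Rˣ ⧸ Z) (y i : Rˣ ⧸ Z)) hcomm'
  let ρ : (Fin n → ℤ) → Rˣ ⧸ Z := fun a => π fun i => Multiplicative.ofAdd (a i)
  have ρadd : ∀ a b, ρ (a + b) = ρ a * ρ b := fun a b => map_mul π _ _
  have ρzero : ρ 0 = 1 := map_one π
  have ρneg : ∀ a, ρ (-a) = (ρ a)⁻¹ := fun a => by
    rw [eq_inv_iff_mul_eq_one, ← ρadd, neg_add_cancel, ρzero]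
  have ρsingle : ∀ i, ρ (Pi.single i 1) = y i := fun i => by
    have : (fun j => Multiplicative.ofAdd ((Pi.single i 1 : Fin n → ℤ) j)) =
        Pi.mulSingle i (Multiplicative.ofAdd (1 : ℤ)) := by
      ext j
      by_cases h : j = i
      · subst h; simp
      · simp [h]
    change π _ = _
    rw [this, MonoidHom.noncommPiCoprod_mulSingle, zpowersHom_apply, toAdd_ofAdd, zpow_one]
  refine ⟨fun a => (ρ a).out, fun a b => hmk _ _ ?_, fun i => hmk _ _ ?_,
    fun Q hQc hQy hQm hQi a => ?_⟩
  · rw [QuotientGroup.mk_mul]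
    simp only [QuotientGroup.out_eq', ρadd]
  · rw [QuotientGroup.out_eq', ρsingle]
  · suffices H : ∀ a, ∀ u : Rˣ, (u : Rˣ ⧸ Z) = ρ a → Q a u from H a _ (QuotientGroup.out_eq' _)
    refine Pi.int_induction ?_ ?_ ?_ ?_
    · intro u hu
      rw [ρzero, ← QuotientGroup.mk_one] at hu
      obtain ⟨c, rfl⟩ := hmk _ _ hu
      simpa using hQc c
    · intro i u hu
      rw [ρsingle] at hu
      obtain ⟨c, rfl⟩ := hmk _ _ hu
      simpa using hQm _ _ _ _ (hQc c) (hQy i)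
    · intro a b ha hb u hu
      have := hQm a b (ρ a).out ((ρ a).out⁻¹ * u) (ha _ (QuotientGroup.out_eq' _)) (hb _ ?_)
      · simpa using this
      · rw [QuotientGroup.mk_mul, hu, QuotientGroup.mk_inv, QuotientGroup.out_eq', ρadd,
          inv_mul_cancel_left]
    · intro a ha u hu
      have := hQi a u⁻¹ (ha _ ?_)
      · simpa using this
      · rw [QuotientGroup.mk_inv, hu, ρneg, inv_inv]

end Monomials

/-- The Laurent monomials commute up to the bicharacter of the commutation matrix. -/
theorem exists_commuting_monomials {k : Type*} [Field k] {R : Type*} [Ring R] [Algebra k R] {n : ℕ}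
    (y : Fin n → Rˣ) (L : Fin n → Fin n → kˣ)
    (hy : ∀ i j, y i * y j = unitScalar k R (L i j) * (y j * y i)) :
    ∃ Y : (Fin n → ℤ) → Rˣ,
      (∀ a b, ∃ c : kˣ, Y a * Y b = unitScalar k R c * Y (a + b)) ∧
      (∀ i, ∃ c : kˣ, Y (Pi.single i 1) = unitScalar k R c * y i) ∧
      (∀ a b, Y a * Y b = unitScalar k R (bicharacter L a b) * (Y b * Y a)) ∧
      ∀ Q : (Fin n → ℤ) → Rˣ → Prop, (∀ c, Q 0 (unitScalar k R c)) →
        (∀ i, Q (Pi.single i 1) (y i)) → (∀ a b u v, Q a u → Q b v → Q (a + b) (u * v)) →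
        (∀ a u, Q a u → Q (-a) u⁻¹) → ∀ a, Q a (Y a) := by
  obtain ⟨Y, hmul, hsingle, hind⟩ := exists_monomials y L hy
  have hYy : ∀ a, ∀ j, Y a * y j =
      unitScalar k R (bicharacter L a (Pi.single j 1)) * (y j * Y a) := by
    refine hind (fun a u => ∀ j, u * y j =
      unitScalar k R (bicharacter L a (Pi.single j 1)) * (y j * u)) ?_ ?_ ?_ ?_
    · intro c j
      rw [bicharacter_zero_left, map_one, one_mul, unitScalar_mul_comm]
    · intro i j
      rw [bicharacter_single_single, hy]
    · intro a b u v hu hv j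
      rw [mul_assoc, hv, ← mul_assoc, ← unitScalar_mul_comm, mul_assoc, ← mul_assoc u, hu,
        bicharacter_add_left, map_mul, ← map_mul, mul_comm, map_mul]
      simp only [mul_assoc]
    · intro a u hu j
      rw [bicharacter_neg_left, inv_mul_eq_iff_eq_mul, ← mul_assoc u, ← unitScalar_mul_comm,
        mul_assoc _ u,
        ← mul_assoc u, hu]
      simp [mul_assoc]
  have hYY : ∀ b, ∀ a, Y a * Y b = unitScalar k R (bicharacter L a b) * (Y b * Y a) := by
    refine hind (fun b v => ∀ a, Y a * v = unitScalar k R (bicharacter L a b) * (v * Y a))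
      ?_ ?_ ?_ ?_
    · intro c a
      rw [bicharacter_zero_right, map_one, one_mul, unitScalar_mul_comm]
    · intro i a
      exact hYy a i
    · intro b b' u v hu hv a
      rw [← mul_assoc, hu, mul_assoc, mul_assoc, hv, ← mul_assoc u, ← unitScalar_mul_comm,
        bicharacter_add_right, map_mul]
      simp only [mul_assoc]
    · intro b v hv a
      have h := hv a
      rw [bicharacter_neg_right, map_inv, eq_inv_mul_iff_mul_eq, eq_inv_mul_iff_mul_eq, ← mul_assoc,
        ← mul_assoc, ← unitScalar_mul_comm, mul_assoc _ v, ← h, mul_inv_cancel_right]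
  exact ⟨Y, hmul, hsingle, fun a b => hYY b a, hind⟩

section Shift

open MvPolynomial MonomialOrder

variable {k : Type*} [Field k] {n : ℕ}

/-- The translation `w_i ↦ w_i - a_i` of the polynomial ring. -/
noncomputable def intShift (k : Type*) [Field k] (a : Fin n → ℤ) :
    MvPolynomial (Fin n) k →ₐ[k] MvPolynomial (Fin n) k :=
  aeval fun i => X i - C (a i : k)

@[simp]
theorem intShift_X (a : Fin n → ℤ) (i : Fin n) :
    intShift k a (X i) = X i - C (a i : k) := by
  simp [intShift]

theorem eval_intShift (a : Fin n → ℤ) (x : Fin n → k) (p : MvPolynomial (Fin n) k) :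
    eval x (intShift k a p) = eval (fun i => x i - a i) p := by
  induction p using MvPolynomial.induction_on with
  | C c => simp [intShift]
  | add p q hp hq => simp [hp, hq]
  | mul_X p i hp => simp [hp]

variable (ord : MonomialOrder (Fin n))

theorem intShift_monomial_monic (a : Fin n → ℤ) (e : Fin n →₀ ℕ) :
    ord.Monic (intShift k a (monomial e 1)) ∧ ord.degree (intShift k a (monomial e 1)) = e := by
  have hX : ∀ i, ord.toSyn (ord.degree (-C (a i : k) : MvPolynomial (Fin n) k)) <
      ord.toSyn (ord.degree (X i : MvPolynomial (Fin n) k)) := fun i => by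
    rw [← C_neg, ord.degree_C, ord.degree_X, map_zero]
    refine (ord.zero_le _).lt_of_ne' ?_
    simp
  induction e using Finsupp.induction_linear with
  | zero => simp
  | add e f he hf =>
    rw [← one_mul (1 : k), ← monomial_mul, map_mul]
    exact ⟨he.1.mul hf.1, by rw [ord.degree_mul he.1.ne_zero hf.1.ne_zero, he.2, hf.2]⟩
  | single i m =>
    rw [← X_pow_eq_monomial, map_pow, intShift_X, sub_eq_add_neg]
    have hm : ord.leadingCoeff (X i + -C (a i : k)) = 1 :=
      MonomialOrder.Monic.add_of_lt ord.monic_X (hX i)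
    refine ⟨?_, ?_⟩
    · rw [MonomialOrder.Monic, ord.leadingCoeff_pow, hm, one_pow]
    · rw [ord.degree_pow, ord.degree_add_of_lt (hX i), ord.degree_X]
      simp

theorem intShift_monomial_sub_coeff (a : Fin n → ℤ) (e : Fin n →₀ ℕ) (c : k) (d : Fin n →₀ ℕ)
    (h : ord.toSyn e ≤ ord.toSyn d) :
    coeff d (intShift k a (monomial e c) - monomial e c) = 0 := by
  obtain ⟨hm, hd⟩ := intShift_monomial_monic (k := k) ord a e
  have hc : (monomial e c : MvPolynomial (Fin n) k) = c • monomial e 1 := by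
    rw [smul_monomial, smul_eq_mul, mul_one]
  rw [hc, map_smul, ← smul_sub, coeff_smul, coeff_sub, coeff_monomial]
  split_ifs with hed
  · have h1 := hm.coeff_degree
    rw [hd] at h1
    rw [← hed, h1, sub_self, smul_zero]
  · rw [ord.coeff_eq_zero_of_lt, sub_zero, smul_zero]
    rw [hd]
    exact h.lt_of_ne fun h' => hed (ord.toSyn.injective h')

theorem intShift_sub_coeff (a : Fin n → ℤ) (p : MvPolynomial (Fin n) k) (d : Fin n →₀ ℕ)
    (h : ord.toSyn (ord.degree p) ≤ ord.toSyn d) : coeff d (intShift k a p - p) = 0 := by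
  have hp : intShift k a p - p = ∑ e ∈ p.support,
      (intShift k a (monomial e (coeff e p)) - monomial e (coeff e p)) := by
    rw [Finset.sum_sub_distrib, ← map_sum, ← p.as_sum]
  rw [hp, coeff_sum]
  exact Finset.sum_eq_zero fun e he =>
    intShift_monomial_sub_coeff ord a e _ d ((ord.le_degree he).trans h)

theorem coeff_intShift (a : Fin n → ℤ) (p : MvPolynomial (Fin n) k) (d : Fin n →₀ ℕ)
    (h : ord.toSyn (ord.degree p) ≤ ord.toSyn d) : coeff d (intShift k a p) = coeff d p := by
  rw [← sub_eq_zero, ← coeff_sub, intShift_sub_coeff ord a p d h]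

theorem degree_intShift (a : Fin n → ℤ) (p : MvPolynomial (Fin n) k) :
    ord.degree (intShift k a p) = ord.degree p := by
  rcases eq_or_ne p 0 with rfl | hp
  · simp
  apply ord.toSyn.injective
  apply le_antisymm
  · rw [ord.degree_le_iff]
    intro d hd
    by_contra! hlt
    rw [mem_support_iff, coeff_intShift ord a p d hlt.le] at hd
    exact hd (ord.coeff_eq_zero_of_lt hlt)
  · apply ord.le_degree
    rw [mem_support_iff, coeff_intShift ord a p _ le_rfl]
    exact ord.coeff_degree_ne_zero_iff.2 hp

theorem leadingCoeff_intShift (a : Fin n → ℤ) (p : MvPolynomial (Fin n) k) :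
    ord.leadingCoeff (intShift k a p) = ord.leadingCoeff p := by
  rw [MonomialOrder.leadingCoeff, degree_intShift, coeff_intShift ord a p _ le_rfl]
  rfl

theorem degree_intShift_sub_lt (a : Fin n → ℤ) (p : MvPolynomial (Fin n) k)
    (h : intShift k a p - p ≠ 0) :
    ord.toSyn (ord.degree (intShift k a p - p)) < ord.toSyn (ord.degree p) := by
  by_contra! hle
  exact ord.coeff_degree_ne_zero_iff.2 h (intShift_sub_coeff ord a p _ hle)

theorem eq_C_of_intShift_eq [CharZero k] (p : MvPolynomial (Fin n) k)
    (h : ∀ a : Fin n → ℤ, intShift k a p = p) : p = C (eval 0 p) := by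
  refine funext_set (fun _ => Set.range ((↑) : ℤ → k))
    (fun _ => Set.infinite_range_of_injective Int.cast_injective) fun x hx => ?_
  choose a ha using fun i => hx i (Set.mem_univ i)
  have h1 := eval_intShift (-a) (0 : Fin n → k) p
  rw [h] at h1
  rw [eval_C, h1]
  congr 2
  ext i
  simp [ha]

end Shift

/-- The data of commuting elements `ev (X i)` and Laurent monomials `Y a` shifting them, inside an
algebra `R`. -/
structure WeylSystem (k : Type*) [Field k] (R : Type*) [Ring R] [Algebra k R] (n : ℕ) where
  Y : (Fin n → ℤ) → Rˣ
  cocycle : (Fin n → ℤ) → (Fin n → ℤ) → kˣ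
  Y_mul : ∀ a b, Y a * Y b = unitScalar k R (cocycle a b) * Y (a + b)
  ev : MvPolynomial (Fin n) k →ₐ[k] R
  Y_ev : ∀ a i, (Y a : R) * ev (MvPolynomial.X i) =
    (ev (MvPolynomial.X i) - algebraMap k R (a i)) * Y a

namespace WeylSystem

open MvPolynomial

variable {k : Type*} [Field k] {R : Type*} [Ring R] [Algebra k R] {n : ℕ} (W : WeylSystem k R n)

theorem Y_mul_ev (a : Fin n → ℤ) (p : MvPolynomial (Fin n) k) :
    (W.Y a : R) * W.ev p = W.ev (intShift k a p) * W.Y a := by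
  induction p using MvPolynomial.induction_on with
  | C c =>
    rw [← MvPolynomial.algebraMap_eq, AlgHom.commutes, AlgHom.commutes, AlgHom.commutes,
      Algebra.commutes]
  | add p q hp hq => simp only [map_add, mul_add, add_mul, hp, hq]
  | mul_X p i hp =>
    rw [map_mul, ← mul_assoc, hp, mul_assoc, W.Y_ev, ← mul_assoc, map_mul, map_mul, intShift_X,
      map_sub, ← MvPolynomial.algebraMap_eq, AlgHom.commutes]

theorem Y_mul_coe (a b : Fin n → ℤ) :
    (W.Y a : R) * W.Y b = (W.cocycle a b : k) • (W.Y (a + b) : R) := by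
  rw [← Units.val_mul, W.Y_mul, Algebra.smul_def]
  rfl

theorem ev_injective [CharZero k] [Nontrivial R] : Function.Injective W.ev := by
  rw [injective_iff_map_eq_zero]
  let ord : MonomialOrder (Fin n) := MonomialOrder.lex
  suffices H : ∀ s : ord.syn, ∀ p, ord.toSyn (ord.degree p) = s → W.ev p = 0 → p = 0 from
    fun p => H _ p rfl
  intro s
  induction s using ord.wellFoundedLT_syn.wf.induction with
  | _ s ih =>
    rintro p rfl hp
    have hshift : ∀ a, W.ev (intShift k a p) = 0 := fun a => by
      rw [← (W.Y a).mul_left_eq_zero, ← Y_mul_ev, hp, mul_zero]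
    have hconst := eq_C_of_intShift_eq p fun a => by
      by_contra hne
      rw [← sub_eq_zero] at hne
      exact hne (ih _ (degree_intShift_sub_lt ord a p hne) _ rfl
        (by rw [map_sub, hshift, hp, sub_zero]))
    rw [hconst, ← MvPolynomial.algebraMap_eq, AlgHom.commutes,
      FaithfulSMul.algebraMap_eq_zero_iff] at hp
    rw [hconst, hp, C_0]

/-- The linear map sending a family of polynomials `f a` to `∑ f a (w) Y^a`. -/
noncomputable def toAlg : ((Fin n → ℤ) →₀ MvPolynomial (Fin n) k) →ₗ[k] R :=
  Finsupp.lsum k fun a => (LinearMap.mulRight k (W.Y a : R)) ∘ₗ W.ev.toLinearMap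

theorem toAlg_apply (f : (Fin n → ℤ) →₀ MvPolynomial (Fin n) k) :
    W.toAlg f = f.sum fun a p => W.ev p * W.Y a := rfl

@[simp]
theorem toAlg_single (a : Fin n → ℤ) (p : MvPolynomial (Fin n) k) :
    W.toAlg (Finsupp.single a p) = W.ev p * W.Y a := by
  simp [toAlg]

theorem eq_zero_of_sum_eigen [CharZero k] {M : Type*} [AddCommGroup M] [Module k M]
    (T : Fin n → Module.End k M) (A : Finset (Fin n → ℤ)) (t : (Fin n → ℤ) → M)
    (ht : ∀ a i, T i (t a) = (a i : k) • t a) (h0 : ∑ a ∈ A, t a = 0) : ∀ a ∈ A, t a = 0 := by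
  induction A using Finset.induction_on generalizing t with
  | empty => simp
  | insert b A hb ih =>
    rw [Finset.sum_insert hb] at h0
    have h1 : ∀ a ∈ A, t a = 0 := by
      intro a ha
      obtain ⟨i, hi⟩ := Function.ne_iff.1 (ne_of_mem_of_not_mem ha hb)
      have h2 := ih (fun a => ((a i : k) - b i) • t a)
        (fun a j => by simp only [map_smul, ht]; rw [smul_comm]) ?_ a ha
      · refine (smul_eq_zero.1 h2).resolve_left ?_
        rw [← ne_eq, sub_ne_zero]
        exact_mod_cast hi
      · have h3 := congrArg (fun x => T i x - (b i : k) • x) h0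
        simp only [map_add, map_sum, ht, smul_add, Finset.smul_sum, map_zero, smul_zero,
          sub_zero] at h3
        simp only [sub_smul, Finset.sum_sub_distrib]
        rw [← h3]
        abel
    rw [Finset.sum_eq_zero h1, add_zero] at h0
    simp only [Finset.mem_insert, forall_eq_or_imp]
    exact ⟨h0, h1⟩

theorem toAlg_injective [CharZero k] [Nontrivial R] : Function.Injective W.toAlg := by
  rw [injective_iff_map_eq_zero]
  intro f hf
  ext1 a
  by_cases ha : a ∈ f.support
  swap
  · simpa using ha
  have := eq_zero_of_sum_eigen
    (fun i => LinearMap.mulLeft k (W.ev (X i)) - LinearMap.mulRight k (W.ev (X i)))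
    f.support (fun a => W.ev (f a) * W.Y a) (fun a i => ?_) hf a ha
  · rw [Units.mul_left_eq_zero] at this
    exact W.ev_injective (by simpa using this)
  · simp only [LinearMap.sub_apply, LinearMap.mulLeft_apply, LinearMap.mulRight_apply]
    have h : W.ev (X i) * (W.ev (f a) * W.Y a) = W.ev (f a) * (W.ev (X i) * W.Y a) := by
      rw [← mul_assoc, ← mul_assoc, ← map_mul, ← map_mul, mul_comm]
    rw [mul_assoc (W.ev (f a)), W.Y_ev, sub_mul, mul_sub, ← Algebra.smul_def, mul_smul_comm, h,
      sub_sub_cancel]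

/-- The product on coefficient families corresponding to multiplication in `R`. -/
noncomputable def conv (f g : (Fin n → ℤ) →₀ MvPolynomial (Fin n) k) :
    (Fin n → ℤ) →₀ MvPolynomial (Fin n) k :=
  ∑ a ∈ f.support, ∑ b ∈ g.support,
    Finsupp.single (a + b) ((W.cocycle a b : k) • (f a * intShift k a (g b)))

theorem toAlg_conv (f g : (Fin n → ℤ) →₀ MvPolynomial (Fin n) k) :
    W.toAlg (W.conv f g) = W.toAlg f * W.toAlg g := by
  rw [toAlg_apply W f, toAlg_apply W g, Finsupp.sum, Finsupp.sum, Finset.sum_mul_sum, conv, map_sum]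
  refine Finset.sum_congr rfl fun a _ => ?_
  rw [map_sum]
  refine Finset.sum_congr rfl fun b _ => ?_
  rw [toAlg_single, map_smul, map_mul, smul_mul_assoc, ← mul_smul_comm, ← Y_mul_coe, mul_assoc,
    ← mul_assoc (W.ev _) (W.Y a : R), ← Y_mul_ev]
  simp only [mul_assoc]

theorem conv_apply (f g : (Fin n → ℤ) →₀ MvPolynomial (Fin n) k) (c : Fin n → ℤ) :
    W.conv f g c = ∑ a ∈ f.support, ∑ b ∈ g.support,
      if a + b = c then (W.cocycle a b : k) • (f a * intShift k a (g b)) else 0 := by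
  simp only [conv, Finsupp.finsetSum_apply, Finsupp.single_apply]

/-- `a` is the lexicographically largest exponent of the family `f`. -/
def IsLead (f : (Fin n → ℤ) →₀ MvPolynomial (Fin n) k) (a : Fin n → ℤ) : Prop :=
  a ∈ f.support ∧ ∀ b ∈ f.support, toLex b ≤ toLex a

theorem exists_isLead {f : (Fin n → ℤ) →₀ MvPolynomial (Fin n) k} (hf : f ≠ 0) :
    ∃ a, IsLead f a :=
  Finset.exists_max_image f.support toLex (Finsupp.support_nonempty_iff.2 hf)

theorem IsLead.unique {f : (Fin n → ℤ) →₀ MvPolynomial (Fin n) k} {a b : Fin n → ℤ}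
    (ha : IsLead f a) (hb : IsLead f b) : a = b :=
  toLex.injective (le_antisymm (hb.2 a ha.1) (ha.2 b hb.1))

theorem IsLead.conv_apply {f g : (Fin n → ℤ) →₀ MvPolynomial (Fin n) k} {a b : Fin n → ℤ}
    (ha : IsLead f a) (hb : IsLead g b) :
    W.conv f g (a + b) = (W.cocycle a b : k) • (f a * intShift k a (g b)) := by
  have key : ∀ a' ∈ f.support, ∀ b' ∈ g.support, a' + b' = a + b → a' = a ∧ b' = b := by
    intro a' ha' b' hb' h
    have h1 := ha.2 a' ha'
    have h2 := hb.2 b' hb'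
    have h3 := (add_eq_add_iff_eq_and_eq h1 h2).1 (congrArg toLex h)
    exact ⟨toLex.injective h3.1, toLex.injective h3.2⟩
  rw [W.conv_apply, Finset.sum_eq_single a, Finset.sum_eq_single b, if_pos rfl]
  · exact fun b' hb' hne => if_neg fun h => hne (key a ha.1 b' hb' h).2
  · exact fun h => absurd hb.1 h
  · exact fun a' ha' hne => Finset.sum_eq_zero fun b' hb' =>
      if_neg fun h => hne (key a' ha' b' hb' h).1
  · exact fun h => absurd ha.1 h

theorem IsLead.conv {f g : (Fin n → ℤ) →₀ MvPolynomial (Fin n) k} {a b : Fin n → ℤ}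
    (ha : IsLead f a) (hb : IsLead g b) : IsLead (W.conv f g) (a + b) := by
  constructor
  · rw [Finsupp.mem_support_iff, ha.conv_apply W hb]
    have hg : intShift k a (g b) ≠ 0 := by
      rw [← MonomialOrder.lex.leadingCoeff_ne_zero_iff, leadingCoeff_intShift,
        MonomialOrder.lex.leadingCoeff_ne_zero_iff]
      exact Finsupp.mem_support_iff.1 hb.1
    exact smul_ne_zero (Units.ne_zero _) (mul_ne_zero (Finsupp.mem_support_iff.1 ha.1) hg)
  · intro c hc
    rw [Finsupp.mem_support_iff, W.conv_apply] at hc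
    obtain ⟨a', ha', h⟩ := Finset.exists_ne_zero_of_sum_ne_zero hc
    obtain ⟨b', hb', h⟩ := Finset.exists_ne_zero_of_sum_ne_zero h
    have hc' : a' + b' = c := by
      by_contra hne
      exact h (if_neg hne)
    rw [← hc', toLex_add, toLex_add]
    exact add_le_add (ha.2 a' ha') (hb.2 b' hb')

open Classical in
/-- The leading term of a family, with the polynomial coefficient replaced by its leading
coefficient. -/
noncomputable def leadTerm (f : (Fin n → ℤ) →₀ MvPolynomial (Fin n) k) : R :=
  if h : ∃ a, IsLead f a then
    MonomialOrder.lex.leadingCoeff (f h.choose) • (W.Y h.choose : R) else 0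

theorem leadTerm_eq {f : (Fin n → ℤ) →₀ MvPolynomial (Fin n) k} {a : Fin n → ℤ}
    (ha : IsLead f a) : W.leadTerm f = MonomialOrder.lex.leadingCoeff (f a) • (W.Y a : R) := by
  have h : ∃ a, IsLead f a := ⟨a, ha⟩
  rw [leadTerm, dif_pos h, h.choose_spec.unique ha]

@[simp]
theorem leadTerm_zero : W.leadTerm 0 = 0 :=
  dif_neg fun ⟨_, h⟩ => by simp [IsLead] at h

theorem leadTerm_conv (f g : (Fin n → ℤ) →₀ MvPolynomial (Fin n) k) :
    W.leadTerm (W.conv f g) = W.leadTerm f * W.leadTerm g := by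
  rcases eq_or_ne f 0 with rfl | hf
  · simp [conv]
  rcases eq_or_ne g 0 with rfl | hg
  · simp [conv]
  obtain ⟨a, ha⟩ := exists_isLead hf
  obtain ⟨b, hb⟩ := exists_isLead hg
  rw [W.leadTerm_eq (ha.conv W hb), W.leadTerm_eq ha, W.leadTerm_eq hb, ha.conv_apply W hb,
    smul_mul_smul_comm, Y_mul_coe, smul_smul, MvPolynomial.smul_eq_C_mul,
    MonomialOrder.leadingCoeff_mul, MonomialOrder.leadingCoeff_mul, leadingCoeff_intShift,
    MonomialOrder.leadingCoeff_C, mul_comm]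

theorem exists_leadTerm_eq {f : (Fin n → ℤ) →₀ MvPolynomial (Fin n) k} (hf : f ≠ 0) :
    ∃ (c : kˣ) (a : Fin n → ℤ), W.leadTerm f = (unitScalar k R c * W.Y a : Rˣ) := by
  obtain ⟨a, ha⟩ := exists_isLead hf
  refine ⟨Units.mk0 _ (MonomialOrder.lex.leadingCoeff_ne_zero_iff.2
    (Finsupp.mem_support_iff.1 ha.1)), a, ?_⟩
  rw [W.leadTerm_eq ha, Algebra.smul_def]
  rfl

end WeylSystem

namespace WeylSystem

open MvPolynomial

variable {k : Type*} [Field k] {R : Type*} [Ring R] [Algebra k R] {n : ℕ}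

open scoped IsMulCommutative in
/-- Evaluation of polynomials at commuting elements of a noncommutative algebra. -/
theorem exists_eval_of_commute (w : Fin n → R) (hw : ∀ i j, w i * w j = w j * w i) :
    ∃ ev : MvPolynomial (Fin n) k →ₐ[k] R, ∀ i, ev (X i) = w i := by
  have hcomm : ∀ a ∈ Set.range w, ∀ b ∈ Set.range w, a * b = b * a := by
    rintro _ ⟨i, rfl⟩ _ ⟨j, rfl⟩
    exact hw i j
  let S := Algebra.adjoin k (Set.range w)
  have : IsMulCommutative S := Algebra.isMulCommutative_adjoin k hcomm
  refine ⟨S.val.comp (aeval fun i => (⟨w i, Algebra.subset_adjoin ⟨i, rfl⟩⟩ : S)), fun i => ?_⟩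
  simp

theorem exists_of_units (y : Fin n → Rˣ) (w : Fin n → R) (L : Fin n → Fin n → kˣ)
    (hy : ∀ i j, y i * y j = unitScalar k R (L i j) * (y j * y i))
    (hw : ∀ i j, w i * w j = w j * w i)
    (hyw : ∀ i j, (y j : R) * w i = (w i - if i = j then 1 else 0) * y j) :
    ∃ W : WeylSystem k R n, (∀ i, W.ev (X i) = w i) ∧
      (∀ i, ∃ c : kˣ, W.Y (Pi.single i 1) = unitScalar k R c * y i) ∧
      ∀ a b, W.Y a * W.Y b = unitScalar k R (bicharacter L a b) * (W.Y b * W.Y a) := by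
  obtain ⟨Y, hmul, hsingle, hYY, hind⟩ := exists_commuting_monomials y L hy
  obtain ⟨ev, hev⟩ := exists_eval_of_commute (k := k) w hw
  choose c hc using hmul
  have hYw : ∀ a, ∀ i, (Y a : R) * w i = (w i - algebraMap k R (a i)) * Y a := by
    refine hind (fun a u => ∀ i, (u : R) * w i = (w i - algebraMap k R (a i)) * u) ?_ ?_ ?_ ?_
    · intro c i
      simpa using Algebra.commutes (c : k) (w i)
    · intro j i
      rw [hyw]
      by_cases h : i = j
      · subst h; simp
      · simp [h]
    · intro a b u v hu hv i
      rw [Units.val_mul, mul_assoc, hv, ← mul_assoc, mul_sub, hu, ← Algebra.commutes, ← sub_mul,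
        ← mul_assoc, sub_sub, ← map_add, Pi.add_apply, Int.cast_add]
    · intro a u hu i
      rw [Units.inv_mul_eq_iff_eq_mul, ← mul_assoc, mul_sub, hu, ← Algebra.commutes, ← sub_mul]
      simp
  exact ⟨⟨Y, c, hc, ev, fun a i => by rw [hev, hYw]⟩, hev, hsingle, hYY⟩

end WeylSystem

namespace WeylSystem

open MvPolynomial

variable {k : Type*} [Field k] {R : Type*} [Ring R] [Algebra k R] {n : ℕ} (W : WeylSystem k R n)

theorem Y_zero : W.Y 0 = unitScalar k R (W.cocycle 0 0) := by
  have h := W.Y_mul 0 0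
  rw [add_zero] at h
  exact mul_right_cancel h

theorem Y_inv (a : Fin n → ℤ) : ∃ c : kˣ, (W.Y a)⁻¹ = unitScalar k R c * W.Y (-a) := by
  have h := W.Y_mul (-a) a
  rw [neg_add_cancel, Y_zero, ← map_mul] at h
  refine ⟨(W.cocycle (-a) a * W.cocycle 0 0)⁻¹, ?_⟩
  rw [map_inv, ← h]
  group

/-- The subalgebra of all `∑ f a (w) Y^a`. -/
noncomputable def range : Subalgebra k R :=
  (LinearMap.range W.toAlg).toSubalgebra
    ⟨Finsupp.single 0 (C ((W.cocycle 0 0)⁻¹ : kˣ)), by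
      rw [toAlg_single, Y_zero, ← algebraMap_eq, AlgHom.commutes]
      change ((unitScalar k R (W.cocycle 0 0)⁻¹ * unitScalar k R (W.cocycle 0 0) : Rˣ) : R) = 1
      rw [← map_mul, inv_mul_cancel, map_one, Units.val_one]⟩
    (by
      rintro _ _ ⟨f, rfl⟩ ⟨g, rfl⟩
      exact ⟨_, W.toAlg_conv f g⟩)

theorem mem_range {r : R} : r ∈ W.range ↔ ∃ f, W.toAlg f = r := Iff.rfl

theorem Y_mem_range (a : Fin n → ℤ) : (W.Y a : R) ∈ W.range :=
  ⟨Finsupp.single a 1, by simp⟩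

theorem unitScalar_mem (S : Subalgebra k R) (c : kˣ) : (unitScalar k R c : R) ∈ S :=
  S.algebraMap_mem (c : k)

theorem ev_mem_range (p : MvPolynomial (Fin n) k) : W.ev p ∈ W.range := by
  have h : W.ev p * W.Y 0 ∈ W.range := ⟨Finsupp.single 0 p, W.toAlg_single 0 p⟩
  have h2 := W.range.mul_mem h (unitScalar_mem W.range (W.cocycle 0 0)⁻¹)
  rwa [mul_assoc, Y_zero, ← Units.val_mul, ← map_mul, mul_inv_cancel, map_one, Units.val_one,
    mul_one] at h2

theorem Y_inv_mem_range (a : Fin n → ℤ) : ((W.Y a)⁻¹ : Rˣ).val ∈ W.range := by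
  obtain ⟨c, hc⟩ := W.Y_inv a
  rw [hc]
  exact W.range.mul_mem (unitScalar_mem _ c) (W.Y_mem_range _)

end WeylSystem

section Presentations

variable {k : Type u} [Field k] {n : ℕ} {Λ : Matrix (Fin n) (Fin n) k}

/-- The entries of a multiplicatively antisymmetric matrix as units. -/
def Matrix.MulAntisymmetric.units (h : Λ.MulAntisymmetric) (i j : Fin n) : kˣ :=
  ⟨Λ i j, Λ j i, h.2 i j, h.2 j i⟩

@[simp]
theorem Matrix.MulAntisymmetric.coe_units (h : Λ.MulAntisymmetric) (i j : Fin n) :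
    (h.units i j : k) = Λ i j := rfl

namespace QuantumTorus

theorem y_mul_y (i j : Fin n) : y k Λ i * y k Λ j = Λ i j • (y k Λ j * y k Λ i) := by
  have := RingQuot.mkAlgHom_rel k (QTorusRel.comm (k := k) (Λ := Λ) i j)
  rwa [map_mul, map_mul, map_mul, AlgHom.commutes, ← Algebra.smul_def] at this

theorem y_mul_yinv (i : Fin n) : y k Λ i * yinv k Λ i = 1 := by
  have := RingQuot.mkAlgHom_rel k (QTorusRel.mul_inv (k := k) (Λ := Λ) i)
  rwa [map_mul, map_one] at this

theorem yinv_mul_y (i : Fin n) : yinv k Λ i * y k Λ i = 1 := by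
  have := RingQuot.mkAlgHom_rel k (QTorusRel.inv_mul (k := k) (Λ := Λ) i)
  rwa [map_mul, map_one] at this

theorem subalgebra_eq_top (S : Subalgebra k (QuantumTorus k Λ)) (hy : ∀ i, y k Λ i ∈ S)
    (hyinv : ∀ i, yinv k Λ i ∈ S) : S = ⊤ := by
  rw [eq_top_iff]
  rintro a -
  obtain ⟨a, rfl⟩ := RingQuot.mkAlgHom_surjective k (QTorusRel k Λ) a
  induction a using FreeAlgebra.induction with
  | grade0 r => rw [AlgHom.commutes]; exact S.algebraMap_mem r
  | grade1 x => cases x with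
    | inl i => exact hy i
    | inr i => exact hyinv i
  | mul a b ha hb => rw [map_mul]; exact S.mul_mem ha hb
  | add a b ha hb => rw [map_add]; exact S.add_mem ha hb

theorem exists_lift {R : Type*} [Ring R] [Algebra k R] (u : Fin n → Rˣ)
    (hu : ∀ i j, (u i : R) * u j = Λ i j • ((u j : R) * u i)) :
    ∃ φ : QuantumTorus k Λ →ₐ[k] R, ∀ i, φ (y k Λ i) = u i := by
  let f : FreeAlgebra k (Fin n ⊕ Fin n) →ₐ[k] R :=
    FreeAlgebra.lift k (Sum.elim (fun i => (u i : R)) fun i => ((u i)⁻¹ : Rˣ))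
  refine ⟨RingQuot.liftAlgHom k ⟨f, ?_⟩, fun i => ?_⟩
  · intro a b h
    cases h with
    | comm i j => simpa [f, Algebra.smul_def] using hu i j
    | mul_inv i => simp [f]
    | inv_mul i => simp [f]
  · exact (RingQuot.liftAlgHom_mkAlgHom_apply _ _ _ _).trans (by simp [f])

/-- The generators as units. -/
noncomputable def yUnit (k : Type u) [Field k] {n : ℕ} (Λ : Matrix (Fin n) (Fin n) k)
    (i : Fin n) : (QuantumTorus k Λ)ˣ :=
  ⟨y k Λ i, yinv k Λ i, y_mul_yinv i, yinv_mul_y i⟩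

theorem yUnit_mul_yUnit (h : Λ.MulAntisymmetric) (i j : Fin n) :
    yUnit k Λ i * yUnit k Λ j =
      unitScalar k _ (h.units i j) * (yUnit k Λ j * yUnit k Λ i) :=
  Units.ext ((y_mul_y i j).trans (Algebra.smul_def _ _))

end QuantumTorus

namespace MixedCrossedAlgebra

theorem y_mul_y (i j : Fin n) : y k Λ n le_rfl i * y k Λ n le_rfl j =
    Λ i j • (y k Λ n le_rfl j * y k Λ n le_rfl i) := by
  have := RingQuot.mkAlgHom_rel k (MixedCrossedRel.yy (k := k) (Λ := Λ) (hr := le_rfl) i j)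
  rwa [map_mul, map_mul, map_mul, AlgHom.commutes, ← Algebra.smul_def] at this

theorem x_mul_y_same (i : Fin n) : x k Λ n le_rfl i * y k Λ n le_rfl i =
    y k Λ n le_rfl i * x k Λ n le_rfl i + 1 := by
  have := RingQuot.mkAlgHom_rel k (MixedCrossedRel.xy_same (k := k) (Λ := Λ) (hr := le_rfl) i)
  rwa [map_add, map_mul, map_mul, map_one] at this

theorem x_mul_y_ne (i j : Fin n) (h : i ≠ j) : x k Λ n le_rfl i * y k Λ n le_rfl j =
    (Λ i j)⁻¹ • (y k Λ n le_rfl j * x k Λ n le_rfl i) := by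
  have := RingQuot.mkAlgHom_rel k (MixedCrossedRel.xy_ne (k := k) (Λ := Λ) (hr := le_rfl) i j h)
  rwa [map_mul, map_mul, map_mul, AlgHom.commutes, ← Algebra.smul_def] at this

theorem x_mul_x (i j : Fin n) : x k Λ n le_rfl i * x k Λ n le_rfl j =
    Λ i j • (x k Λ n le_rfl j * x k Λ n le_rfl i) := by
  have := RingQuot.mkAlgHom_rel k (MixedCrossedRel.xx (k := k) (Λ := Λ) (hr := le_rfl) i j)
  rwa [map_mul, map_mul, map_mul, AlgHom.commutes, ← Algebra.smul_def] at this

theorem subalgebra_eq_top (S : Subalgebra k (MixedCrossedAlgebra k Λ n le_rfl))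
    (hy : ∀ i, y k Λ n le_rfl i ∈ S) (hx : ∀ i, x k Λ n le_rfl i ∈ S) : S = ⊤ := by
  rw [eq_top_iff]
  rintro a -
  obtain ⟨a, rfl⟩ := RingQuot.mkAlgHom_surjective k (MixedCrossedRel k Λ n le_rfl) a
  induction a using FreeAlgebra.induction with
  | grade0 r => rw [AlgHom.commutes]; exact S.algebraMap_mem r
  | grade1 x => cases x with
    | inl i => exact hy i
    | inr i => exact hx i
  | mul a b ha hb => rw [map_mul]; exact S.mul_mem ha hb
  | add a b ha hb => rw [map_add]; exact S.add_mem ha hb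

theorem exists_lift {R : Type*} [Ring R] [Algebra k R] (u v : Fin n → R)
    (huu : ∀ i j, u i * u j = Λ i j • (u j * u i))
    (hvu : ∀ i, v i * u i = u i * v i + 1)
    (hvu' : ∀ i j, i ≠ j → v i * u j = (Λ i j)⁻¹ • (u j * v i))
    (hvv : ∀ i j, v i * v j = Λ i j • (v j * v i)) :
    ∃ φ : MixedCrossedAlgebra k Λ n le_rfl →ₐ[k] R,
      (∀ i, φ (y k Λ n le_rfl i) = u i) ∧ ∀ i, φ (x k Λ n le_rfl i) = v i := by
  let f : FreeAlgebra k (Fin n ⊕ Fin n) →ₐ[k] R := FreeAlgebra.lift k (Sum.elim u v)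
  refine ⟨RingQuot.liftAlgHom k ⟨f, ?_⟩, fun i => ?_, fun i => ?_⟩
  · intro a b h
    cases h with
    | yy i j => simpa [f, Algebra.smul_def] using huu i j
    | xy_same i => simpa [f] using hvu i
    | xy_ne i j h =>
      refine Eq.trans ?_ ((hvu' i j h).trans ?_) <;> simp [f, Algebra.smul_def]
    | xx i j => simpa [f, Algebra.smul_def] using hvv i j
  · exact (RingQuot.liftAlgHom_mkAlgHom_apply _ _ _ _).trans (by simp [f])
  · exact (RingQuot.liftAlgHom_mkAlgHom_apply _ _ _ _).trans (by simp [f])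

end MixedCrossedAlgebra

end Presentations

namespace MixedCrossedAlgebra

variable {k : Type u} [Field k] {n : ℕ} {Λ : Matrix (Fin n) (Fin n) k}

/-- The commuting elements `y_i x_i`. -/
noncomputable def w (k : Type u) [Field k] {n : ℕ} (Λ : Matrix (Fin n) (Fin n) k) (i : Fin n) :
    MixedCrossedAlgebra k Λ n le_rfl :=
  y k Λ n le_rfl i * x k Λ n le_rfl i

theorem y_mul_w (h : Λ.MulAntisymmetric) (i j : Fin n) :
    y k Λ n le_rfl j * w k Λ i = (w k Λ i - if i = j then 1 else 0) * y k Λ n le_rfl j := by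
  rw [sub_mul, eq_sub_iff_add_eq, eq_comm, w]
  split_ifs with hij
  · subst hij
    rw [mul_assoc, x_mul_y_same, mul_add, mul_one, one_mul]
  · have h1 : (Λ i j)⁻¹ * Λ i j = 1 := inv_mul_cancel₀ (left_ne_zero_of_mul_eq_one (h.2 i j))
    rw [zero_mul, add_zero, mul_assoc, x_mul_y_ne _ _ hij, mul_smul_comm, ← mul_assoc,
      y_mul_y i j, smul_mul_assoc, smul_smul, h1, one_smul, mul_assoc]

theorem w_mul_w (h : Λ.MulAntisymmetric) (i j : Fin n) :
    w k Λ i * w k Λ j = w k Λ j * w k Λ i := by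
  rcases eq_or_ne i j with rfl | hij
  · rfl
  have h0 : Λ i j ≠ 0 := left_ne_zero_of_mul_eq_one (h.2 i j)
  have h1 : Λ j i = (Λ i j)⁻¹ := eq_inv_of_mul_eq_one_right (h.2 i j)
  have h2 : w k Λ i * w k Λ j = (Λ i j)⁻¹ • (y k Λ n le_rfl i * y k Λ n le_rfl j *
      (x k Λ n le_rfl i * x k Λ n le_rfl j)) := by
    rw [w, w, mul_assoc, ← mul_assoc (x k Λ n le_rfl i), x_mul_y_ne i j hij]
    simp only [smul_mul_assoc, mul_smul_comm, mul_assoc]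
  have h3 : w k Λ j * w k Λ i = Λ i j • (y k Λ n le_rfl j * y k Λ n le_rfl i *
      (x k Λ n le_rfl j * x k Λ n le_rfl i)) := by
    rw [w, w, mul_assoc, ← mul_assoc (x k Λ n le_rfl j), x_mul_y_ne j i hij.symm, h1, inv_inv]
    simp only [smul_mul_assoc, mul_smul_comm, mul_assoc]
  rw [h2, h3, y_mul_y i j, x_mul_x i j]
  simp only [smul_mul_assoc, mul_smul_comm, smul_smul]
  rw [inv_mul_cancel_left₀ h0]

/-- A homomorphism from `S_{n,n}^Λ(k)` inverting the `y_i` yields a Weyl system. -/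
theorem exists_weylSystem (h : Λ.MulAntisymmetric) {R : Type*} [Ring R] [Algebra k R]
    (φ : MixedCrossedAlgebra k Λ n le_rfl →ₐ[k] R) (u : Fin n → Rˣ)
    (hu : ∀ i, φ (y k Λ n le_rfl i) = u i) :
    ∃ W : WeylSystem k R n, (∀ i, W.ev (MvPolynomial.X i) = φ (w k Λ i)) ∧
      (∀ i, ∃ c : kˣ, W.Y (Pi.single i 1) = unitScalar k R c * u i) ∧
      (∀ a b, W.Y a * W.Y b = unitScalar k R (bicharacter h.units a b) * (W.Y b * W.Y a)) ∧
      ∀ s, ∃ f, W.toAlg f = φ s := by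
  obtain ⟨W, hw, hY, hYY⟩ := WeylSystem.exists_of_units (k := k) u (fun i => φ (w k Λ i)) h.units
    (fun i j => by
      ext
      have := congrArg φ (y_mul_y (Λ := Λ) i j)
      rwa [map_smul, map_mul, map_mul, hu, hu, Algebra.smul_def] at this)
    (fun i j => by rw [← map_mul, w_mul_w h, map_mul])
    (fun i j => by
      rw [← hu, ← map_mul, y_mul_w h, map_mul, map_sub]
      split_ifs <;> simp)
  refine ⟨W, hw, hY, hYY, fun s => W.mem_range.1 ?_⟩
  suffices H : W.range.comap φ = ⊤ by
    have : s ∈ W.range.comap φ := H ▸ Algebra.mem_top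
    exact this
  refine subalgebra_eq_top _ (fun i => ?_) fun i => ?_ <;> rw [Subalgebra.mem_comap] <;>
    obtain ⟨c, hc⟩ := hY i
  · rw [hu, ← inv_mul_eq_iff_eq_mul.2 hc, ← map_inv]
    exact W.range.mul_mem (WeylSystem.unitScalar_mem _ _) (W.Y_mem_range _)
  · have hx : φ (x k Λ n le_rfl i) = ((u i)⁻¹ : Rˣ) * φ (w k Λ i) := by
      rw [w, map_mul, hu, Units.inv_mul_cancel_left]
    have hi : (u i)⁻¹ = (W.Y (Pi.single i 1))⁻¹ * unitScalar k R c := by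
      rw [hc, mul_inv_rev, inv_mul_cancel_right]
    rw [hx, ← hw, hi]
    exact W.range.mul_mem (W.range.mul_mem (W.Y_inv_mem_range _) (WeylSystem.unitScalar_mem _ _))
      (W.ev_mem_range _)

end MixedCrossedAlgebra

namespace FractionDivisionRing

variable {k : Type u} [Field k] {A : Type u} [Ring A] [Algebra k A] (F : FractionDivisionRing k A)

theorem emb_eq_zero_iff {a : A} : F.emb a = 0 ↔ a = 0 :=
  map_eq_zero_iff F.emb F.emb_injective

theorem ore {a b : A} (hb : b ≠ 0) : ∃ u v : A, v ≠ 0 ∧ a * v = b * u ∧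
    (F.emb b)⁻¹ * F.emb a = F.emb u * (F.emb v)⁻¹ := by
  obtain ⟨u, v, hv, h⟩ := F.frac ((F.emb b)⁻¹ * F.emb a)
  refine ⟨u, v, hv, F.emb_injective ?_, h⟩
  have hb' : F.emb b ≠ 0 := F.emb_eq_zero_iff.not.2 hb
  have hv' : F.emb v ≠ 0 := F.emb_eq_zero_iff.not.2 hv
  rw [eq_mul_inv_iff_mul_eq₀ hv', mul_assoc, inv_mul_eq_iff_eq_mul₀ hb'] at h
  rw [map_mul, map_mul, h]

theorem exists_extend {G : Type*} [GroupWithZero G] (φ : A →*₀ G) (hφ : ∀ a, φ a = 0 → a = 0) :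
    ∃ ψ : F.carrier →*₀ G, ∀ a b, b ≠ 0 → ψ (F.emb a * (F.emb b)⁻¹) = φ a * (φ b)⁻¹ := by
  have hφ' : ∀ {a}, a ≠ 0 → φ a ≠ 0 := fun h h' => h (hφ _ h')
  have he : ∀ {a}, a ≠ 0 → F.emb a ≠ 0 := fun h => F.emb_eq_zero_iff.not.2 h
  have wd : ∀ a b a' b', b ≠ 0 → b' ≠ 0 → F.emb a * (F.emb b)⁻¹ = F.emb a' * (F.emb b')⁻¹ →
      φ a * (φ b)⁻¹ = φ a' * (φ b')⁻¹ := by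
    intro a b a' b' hb hb' h
    obtain ⟨u, v, hv, h1, h2⟩ := F.ore (a := b') hb
    have h3 : a' * v = a * u := by
      apply F.emb_injective
      rw [eq_mul_inv_iff_mul_eq₀ (he hb'), mul_assoc, h2, ← mul_assoc] at h
      rw [map_mul, map_mul, ← h, inv_mul_cancel_right₀ (he hv)]
    have h4 : (φ b)⁻¹ * φ b' = φ u * (φ v)⁻¹ := by
      rw [eq_mul_inv_iff_mul_eq₀ (hφ' hv), mul_assoc, inv_mul_eq_iff_eq_mul₀ (hφ' hb),
        ← map_mul, ← map_mul, h1]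
    rw [eq_mul_inv_iff_mul_eq₀ (hφ' hb'), mul_assoc, h4, ← mul_assoc, ← map_mul, ← h3, map_mul,
      mul_inv_cancel_right₀ (hφ' hv)]
  choose num den hden hfrac using F.frac
  have hspec : ∀ a b, b ≠ 0 → φ (num (F.emb a * (F.emb b)⁻¹)) * (φ (den (F.emb a * (F.emb b)⁻¹)))⁻¹
      = φ a * (φ b)⁻¹ := fun a b hb => wd _ _ _ _ (hden _) hb (hfrac _).symm
  refine ⟨{ toFun := fun d => φ (num d) * (φ (den d))⁻¹, map_zero' := ?_, map_one' := ?_,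
            map_mul' := ?_ }, hspec⟩
  · have := hspec 0 (den 0) (hden 0)
    simpa using this
  · have := hspec (den 0) (den 0) (hden 0)
    rwa [mul_inv_cancel₀ (hφ' (hden 0)), mul_inv_cancel₀ (he (hden 0))] at this
  · intro d d'
    obtain ⟨u, v, hv, h1, h2⟩ := F.ore (a := num d') (hden d)
    have hne : den d' * v ≠ 0 := fun h => by
      have := congrArg F.emb h
      rw [map_mul, map_zero] at this
      exact mul_ne_zero (he (hden d')) (he hv) this
    have h3 : d * d' = F.emb (num d * u) * (F.emb (den d' * v))⁻¹ := by
      conv_lhs => rw [hfrac d, hfrac d']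
      rw [map_mul, map_mul, mul_inv_rev, mul_assoc, ← mul_assoc (_)⁻¹ (F.emb (num d')), h2]
      simp only [mul_assoc]
    have h4 : (φ (den d))⁻¹ * φ (num d') = φ u * (φ v)⁻¹ := by
      rw [eq_mul_inv_iff_mul_eq₀ (hφ' hv), mul_assoc, inv_mul_eq_iff_eq_mul₀ (hφ' (hden d)),
        ← map_mul, ← map_mul, h1]
    have h5 := hspec (num d * u) (den d' * v) hne
    rw [← h3] at h5
    rw [h5, map_mul, map_mul, mul_inv_rev, mul_assoc, ← mul_assoc (φ u), ← h4]
    simp only [mul_assoc]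

theorem exists_algHom {G : Type*} [DivisionRing G] [Algebra k G] (φ : A →ₐ[k] G)
    (hφ : Function.Injective φ) :
    ∃ ψ : F.carrier →ₐ[k] G, ∀ a, ψ (F.emb a) = φ a := by
  have h0 : ∀ a, φ a = 0 → a = 0 := fun a => (map_eq_zero_iff φ hφ).1
  obtain ⟨ψ, hψ⟩ := F.exists_extend (φ : A →+* G).toMonoidWithZeroHom h0
  have hA : Nontrivial A := F.emb.toRingHom.domain_nontrivial
  have hemb : ∀ a, ψ (F.emb a) = φ a := fun a => by
    simpa using hψ a 1 one_ne_zero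
  have hone : ∀ d, ψ (1 + d) = 1 + ψ d := fun d => by
    obtain ⟨a, b, hb, rfl⟩ := F.frac d
    have hb' : F.emb b ≠ 0 := F.emb_eq_zero_iff.not.2 hb
    have hb'' : φ b ≠ 0 := fun h => hb (h0 _ h)
    have h1 := hψ (b + a) b hb
    rw [map_add, add_mul, mul_inv_cancel₀ hb'] at h1
    rw [h1, hψ a b hb]
    change φ (b + a) * (φ b)⁻¹ = 1 + φ a * (φ b)⁻¹
    rw [map_add, add_mul, mul_inv_cancel₀ hb'']
  refine ⟨{ ψ with
    map_add' := fun d d' => ?_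
    commutes' := fun c => ?_ }, hemb⟩
  · change ψ (d + d') = ψ d + ψ d'
    rcases eq_or_ne d 0 with rfl | hd
    · simp
    rw [← mul_inv_cancel_left₀ hd d', ← mul_one_add, map_mul, hone, mul_one_add, ← map_mul]
  · change ψ (algebraMap k _ c) = _
    rw [← F.emb.commutes, hemb, φ.commutes]

end FractionDivisionRing

theorem unitScalar_mul_mul_unitScalar_mul {k R : Type*} [Field k] [Ring R] [Algebra k R]
    (c d : kˣ) (u v : Rˣ) :
    unitScalar k R c * u * (unitScalar k R d * v) = unitScalar k R (c * d) * (u * v) := by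
  rw [map_mul, mul_assoc, mul_assoc, ← mul_assoc u, ← unitScalar_mul_comm, mul_assoc]

theorem unitScalar_injective {k R : Type*} [Field k] [Ring R] [Algebra k R] [Nontrivial R] :
    Function.Injective (unitScalar k R) :=
  Units.map_injective (algebraMap k R).injective

namespace WeylSystem

variable {k : Type*} [Field k] {R : Type*} [Ring R] [Algebra k R] {n : ℕ} (W : WeylSystem k R n)

/-- The image of a Weyl system under a homomorphism. -/
noncomputable def map {R' : Type*} [Ring R'] [Algebra k R'] (g : R →ₐ[k] R') :
    WeylSystem k R' n where
  Y a := Units.map (g : R →* R') (W.Y a)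
  cocycle := W.cocycle
  Y_mul a b := by
    rw [← map_mul, W.Y_mul, map_mul]
    congr 1
    exact Units.ext (g.commutes _)
  ev := g.comp W.ev
  Y_ev a i := by
    have := congrArg g (W.Y_ev a i)
    rwa [map_mul, map_mul, map_sub, g.commutes] at this

theorem toAlg_map {R' : Type*} [Ring R'] [Algebra k R'] (g : R →ₐ[k] R')
    (f : (Fin n → ℤ) →₀ MvPolynomial (Fin n) k) : (W.map g).toAlg f = g (W.toAlg f) := by
  simp only [toAlg_apply, Finsupp.sum, map_sum, map_mul]
  rfl

theorem leadTerm_smul (c : k) (f : (Fin n → ℤ) →₀ MvPolynomial (Fin n) k) :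
    W.leadTerm (c • f) = c • W.leadTerm f := by
  rcases eq_or_ne c 0 with rfl | hc
  · simp
  rcases eq_or_ne f 0 with rfl | hf
  · simp
  obtain ⟨a, ha⟩ := exists_isLead hf
  have ha' : IsLead (c • f) a := by
    rwa [IsLead, Finsupp.support_smul_eq hc]
  rw [W.leadTerm_eq ha, W.leadTerm_eq ha', Finsupp.smul_apply, MvPolynomial.smul_eq_C_mul,
    MonomialOrder.leadingCoeff_mul, MonomialOrder.leadingCoeff_C, smul_smul]

/-- The units of the form `c Y^a`. -/
def monomialUnits : Subgroup Rˣ where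
  carrier := {u | ∃ (c : kˣ) (a : Fin n → ℤ), u = unitScalar k R c * W.Y a}
  mul_mem' := by
    rintro _ _ ⟨c, a, rfl⟩ ⟨d, b, rfl⟩
    refine ⟨c * d * W.cocycle a b, a + b, ?_⟩
    rw [unitScalar_mul_mul_unitScalar_mul, W.Y_mul, map_mul _ (c * d), mul_assoc]
  one_mem' := ⟨(W.cocycle 0 0)⁻¹, 0, by rw [Y_zero, ← map_mul, inv_mul_cancel, map_one]⟩
  inv_mem' := by
    rintro _ ⟨c, a, rfl⟩
    obtain ⟨d, hd⟩ := W.Y_inv a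
    refine ⟨c⁻¹ * d, -a, ?_⟩
    rw [mul_inv_rev, hd, ← map_inv, ← unitScalar_mul_comm, map_mul, mul_assoc]

theorem conv_single_apply (f : (Fin n → ℤ) →₀ MvPolynomial (Fin n) k) (a b : Fin n → ℤ)
    {p : MvPolynomial (Fin n) k} (hp : p ≠ 0) :
    W.conv f (Finsupp.single a p) (b + a) = (W.cocycle b a : k) • (f b * intShift k b p) := by
  rw [conv_apply, Finsupp.support_single _ hp]
  simp only [Finset.sum_singleton, add_left_inj, Finsupp.single_eq_same]
  rw [Finset.sum_ite_eq', ite_eq_left_iff, Finsupp.notMem_support_iff]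
  intro h
  rw [h, zero_mul, smul_zero]

theorem unitScalar_mul_Y_ne_one [CharZero k] [Nontrivial R] (c : kˣ) {a : Fin n → ℤ}
    (ha : a ≠ 0) : unitScalar k R c * W.Y a ≠ 1 := by
  intro h
  obtain ⟨i, hi⟩ := Function.ne_iff.1 ha
  have h1 := W.Y_ev a i
  rw [← inv_eq_iff_mul_eq_one, ← map_inv] at h
  rw [← h] at h1
  replace h1 := (Algebra.commutes _ _).symm.trans h1
  change _ * ((unitScalar k R c⁻¹ : Rˣ) : R) = _ at h1
  rw [(Units.isUnit (unitScalar k R c⁻¹)).mul_left_inj] at h1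
  rw [eq_comm, sub_eq_self, FaithfulSMul.algebraMap_eq_zero_iff, Int.cast_eq_zero] at h1
  exact hi h1

/-- For `a ≠ 0`, no element `c Y^a - 1` is invertible in the range of `toAlg`. -/
theorem toAlg_mul_sub_one_ne [CharZero k] [Nontrivial R] (c : kˣ) {a : Fin n → ℤ} (ha : a ≠ 0)
    (f : (Fin n → ℤ) →₀ MvPolynomial (Fin n) k) :
    W.toAlg f * ((unitScalar k R c * W.Y a : Rˣ) - 1) ≠ 1 := by
  intro h
  have hC : (MvPolynomial.C (c : k) : MvPolynomial (Fin n) k) ≠ 0 := by simp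
  have h1 : W.conv f (Finsupp.single a (MvPolynomial.C (c : k))) - f =
      Finsupp.single 0 (MvPolynomial.C ((W.cocycle 0 0)⁻¹ : kˣ).val) := by
    apply W.toAlg_injective
    rw [map_sub, toAlg_conv, toAlg_single, toAlg_single, ← MvPolynomial.algebraMap_eq,
      AlgHom.commutes, AlgHom.commutes, Y_zero]
    rw [mul_sub, mul_one] at h
    refine h.trans ?_
    change 1 = ((unitScalar k R (W.cocycle 0 0)⁻¹ * unitScalar k R (W.cocycle 0 0) : Rˣ) : R)
    rw [← map_mul, inv_mul_cancel, map_one, Units.val_one]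
  have h2 : ∀ b, b + a ≠ 0 → (f b = 0 ↔ f (b + a) = 0) := by
    intro b hb
    have := congrArg (fun g => g (b + a)) h1
    simp only [Finsupp.sub_apply, Finsupp.single_eq_of_ne hb] at this
    rw [W.conv_single_apply _ _ _ hC, sub_eq_zero] at this
    rw [← this]
    simp [intShift]
  have hf : f.support.Nonempty := by
    rw [Finsupp.support_nonempty_iff]
    rintro rfl
    simp at h
  have hpos : 0 < a ⬝ᵥ a :=
    (Finset.sum_nonneg fun i _ => mul_self_nonneg _).lt_of_ne' (dotProduct_self_eq_zero.not.2 ha)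
  obtain ⟨M, hM, hMmax⟩ := Finset.exists_max_image f.support (fun b => a ⬝ᵥ b) hf
  obtain ⟨m, hm, hmmin⟩ := Finset.exists_min_image f.support (fun b => a ⬝ᵥ b) hf
  have hMa : M + a = 0 := by
    by_contra hne
    have h3 := hMmax (M + a) (by
      rw [Finsupp.mem_support_iff] at hM ⊢
      exact (h2 M hne).not.1 hM)
    rw [dotProduct_add] at h3
    lia
  have hm0 : m = 0 := by
    by_contra hne
    have h3 := hmmin (m - a) (by
      rw [Finsupp.mem_support_iff] at hm ⊢
      refine (h2 (m - a) ?_).not.2 ?_ <;> rwa [sub_add_cancel])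
    rw [dotProduct_sub] at h3
    lia
  have h3 := hmmin M hM
  rw [eq_neg_of_add_eq_zero_left hMa, hm0, dotProduct_neg, dotProduct_zero] at h3
  lia

end WeylSystem

section Fractions

variable {k : Type u} [Field k] {n : ℕ} {Λ : Matrix (Fin n) (Fin n) k}
  (F : FractionDivisionRing k (MixedCrossedAlgebra k Λ n le_rfl))

namespace FractionDivisionRing

theorem emb_y_ne_zero (i : Fin n) : F.emb (MixedCrossedAlgebra.y k Λ n le_rfl i) ≠ 0 := by
  intro h
  have := congrArg F.emb (MixedCrossedAlgebra.x_mul_y_same (Λ := Λ) i)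
  rw [map_add, map_mul, map_mul, map_one, h, mul_zero, zero_mul, zero_add] at this
  exact zero_ne_one this

/-- The generators `y_i` as units of the division ring of fractions. -/
noncomputable def yUnit (i : Fin n) : F.carrierˣ :=
  Units.mk0 _ (F.emb_y_ne_zero i)

@[simp]
theorem coe_yUnit (i : Fin n) :
    (F.yUnit i : F.carrier) = F.emb (MixedCrossedAlgebra.y k Λ n le_rfl i) := rfl

theorem exists_torusHom : ∃ θ : QuantumTorus k Λ →ₐ[k] F.carrier,
    ∀ i, θ (QuantumTorus.y k Λ i) = F.yUnit i :=
  QuantumTorus.exists_lift F.yUnit fun i j => by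
    have := congrArg F.emb (MixedCrossedAlgebra.y_mul_y (Λ := Λ) i j)
    rwa [map_smul, map_mul, map_mul] at this

/-- Every homomorphism from `S_{n,n}^Λ(k)` inverting the `y_i` is injective. -/
theorem injective_of_units (F : FractionDivisionRing k (MixedCrossedAlgebra k Λ n le_rfl))
    (h : Λ.MulAntisymmetric) [CharZero k] {R : Type*} [Ring R] [Nontrivial R] [Algebra k R]
    (φ : MixedCrossedAlgebra k Λ n le_rfl →ₐ[k] R) (u : Fin n → Rˣ)
    (hu : ∀ i, φ (MixedCrossedAlgebra.y k Λ n le_rfl i) = u i) : Function.Injective φ := by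
  rw [injective_iff_map_eq_zero]
  intro s hs
  obtain ⟨W, -, -, -, hW⟩ := MixedCrossedAlgebra.exists_weylSystem h (F.emb.prod φ)
    (fun i => MulEquiv.prodUnits.symm (F.yUnit i, u i)) fun i => Prod.ext rfl (hu i)
  obtain ⟨f, hf⟩ := hW s
  have h1 := (W.toAlg_map (AlgHom.snd k F.carrier R) f).trans (congrArg Prod.snd hf)
  have h2 := (W.toAlg_map (AlgHom.fst k F.carrier R) f).trans (congrArg Prod.fst hf)
  change _ = φ s at h1
  change _ = F.emb s at h2
  rw [hs, ← map_zero (W.map (AlgHom.snd k F.carrier R)).toAlg] at h1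
  rw [(W.map _).toAlg_injective h1, map_zero] at h2
  exact F.emb_eq_zero_iff.1 h2.symm

/-- Units of the division ring of fractions commuting up to scalars do so through the
bicharacter of `Λ` and integer exponents. -/
theorem exists_exponents (h : Λ.MulAntisymmetric) [CharZero k]
    {L' : Fin n → Fin n → kˣ} (u : Fin n → F.carrierˣ)
    (hu : ∀ i j, u i * u j = unitScalar k _ (L' i j) * (u j * u i)) :
    ∃ M : Matrix (Fin n) (Fin n) ℤ, ∀ i j, L' i j = bicharacter h.units (M i) (M j) := by
  obtain ⟨W, -, -, hYY, hW⟩ := MixedCrossedAlgebra.exists_weylSystem h F.emb F.yUnit fun i => rfl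
  choose f hf using hW
  have hinj := W.toAlg_injective
  have fmul : ∀ s t, f (s * t) = W.conv (f s) (f t) := fun s t => hinj (by
    rw [W.toAlg_conv, hf, hf, hf, map_mul])
  have fzero : ∀ s, f s = 0 → s = 0 := fun s hs => by
    rw [← F.emb_eq_zero_iff, ← hf, hs, map_zero]
  have fsmul : ∀ (c : k) s, f (c • s) = c • f s := fun c s => hinj (by
    rw [map_smul, hf, hf, map_smul])
  have hunit : ∀ s, s ≠ 0 → ∃ v ∈ W.monomialUnits, W.leadTerm (f s) = v := fun s hs => by
    obtain ⟨c, a, hca⟩ := W.exists_leadTerm_eq (fun h0 => hs (fzero s h0))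
    exact ⟨_, ⟨c, a, rfl⟩, hca⟩
  have : Nontrivial (MixedCrossedAlgebra k Λ n le_rfl) := F.emb.toRingHom.domain_nontrivial
  have hf1 : W.leadTerm (f 1) = 1 := by
    obtain ⟨v, -, hv⟩ := hunit 1 one_ne_zero
    have h1 := W.leadTerm_conv (f 1) (f 1)
    rw [← fmul, mul_one, hv, ← Units.val_mul, Units.val_inj, left_eq_mul] at h1
    rw [hv, h1, Units.val_one]
  let φ : MixedCrossedAlgebra k Λ n le_rfl →*₀ F.carrier :=
    { toFun := fun s => W.leadTerm (f s)
      map_zero' := by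
        have : f 0 = 0 := hinj (by rw [hf, map_zero, map_zero])
        rw [this, W.leadTerm_zero]
      map_one' := hf1
      map_mul' := fun s t => by rw [fmul, W.leadTerm_conv] }
  obtain ⟨ψ, hψ⟩ := F.exists_extend φ fun s hs => by
    by_contra hne
    obtain ⟨v, -, hv⟩ := hunit s hne
    exact v.ne_zero (hv.symm.trans hs)
  have hψs : ∀ c, Units.map (ψ : F.carrier →* F.carrier) (unitScalar k _ c) =
      unitScalar k _ c := fun c => by
    ext
    have h1 := hψ (algebraMap k _ (c : k)) 1 one_ne_zero
    rw [map_one, inv_one, mul_one, map_one, inv_one, mul_one, F.emb.commutes] at h1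
    refine h1.trans ?_
    change W.leadTerm (f _) = _
    rw [Algebra.algebraMap_eq_smul_one, fsmul, W.leadTerm_smul, hf1,
      ← Algebra.algebraMap_eq_smul_one]
    rfl
  have hψu : ∀ u : F.carrierˣ, Units.map (ψ : F.carrier →* F.carrier) u ∈ W.monomialUnits := by
    intro u
    obtain ⟨s, t, ht, hst⟩ := F.frac u
    have hs : s ≠ 0 := by
      rintro rfl
      simp at hst
    obtain ⟨v, hvW, hv⟩ := hunit s hs
    obtain ⟨v', hvW', hv'⟩ := hunit t ht
    have h1 : Units.map (ψ : F.carrier →* F.carrier) u = v * v'⁻¹ := by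
      ext
      change ψ u = _
      rw [hst, hψ s t ht]
      change W.leadTerm (f s) * (W.leadTerm (f t))⁻¹ = _
      rw [hv, hv', Units.val_mul, Units.val_inv_eq_inv_val]
    rw [h1]
    exact W.monomialUnits.mul_mem hvW (W.monomialUnits.inv_mem hvW')
  choose c M hM using fun i => hψu (u i)
  refine ⟨M, fun i j => ?_⟩
  have h1 := congrArg (Units.map (ψ : F.carrier →* F.carrier)) (hu i j)
  rw [map_mul, map_mul, map_mul, hψs, hM, hM, unitScalar_mul_mul_unitScalar_mul,
    unitScalar_mul_mul_unitScalar_mul, hYY] at h1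
  simp only [← mul_assoc, ← map_mul, mul_left_inj, unitScalar_injective.eq_iff] at h1
  rw [mul_assoc (L' i j), mul_comm (L' i j), mul_comm (c j), mul_right_inj] at h1
  exact h1.symm

/-- A simple quantum torus has a nondegenerate bicharacter. -/
theorem bicharacter_nondegenerate (F : FractionDivisionRing k (MixedCrossedAlgebra k Λ n le_rfl))
    (h : Λ.MulAntisymmetric)
    [CharZero k] [IsSimpleRing (QuantumTorus k Λ)] (a : Fin n → ℤ)
    (ha : ∀ b, bicharacter h.units a b = 1) : a = 0 := by
  by_contra hne
  obtain ⟨θ, hθ⟩ := F.exists_torusHom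
  obtain ⟨W, -, hWy, -, hW⟩ := MixedCrossedAlgebra.exists_weylSystem h F.emb F.yUnit fun i => rfl
  obtain ⟨Y, -, hYy, hYY, hind⟩ := exists_commuting_monomials (k := k) (QuantumTorus.yUnit k Λ)
    h.units (QuantumTorus.yUnit_mul_yUnit h)
  have hθy : ∀ i, Units.map (θ : QuantumTorus k Λ →* F.carrier) (QuantumTorus.yUnit k Λ i) =
      F.yUnit i := fun i => Units.ext (hθ i)
  have hθs : ∀ c, Units.map (θ : QuantumTorus k Λ →* F.carrier) (unitScalar k _ c) =
      unitScalar k _ c := fun c => Units.ext (θ.commutes c)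
  have hθY : ∀ a, ∃ c : kˣ, Units.map (θ : QuantumTorus k Λ →* F.carrier) (Y a) =
      unitScalar k _ c * W.Y a := by
    refine hind (fun a u => ∃ c : kˣ, Units.map (θ : QuantumTorus k Λ →* F.carrier) u =
      unitScalar k _ c * W.Y a) ?_ ?_ ?_ ?_
    · intro c
      exact ⟨c * (W.cocycle 0 0)⁻¹, by
        rw [hθs, W.Y_zero, ← map_mul, inv_mul_cancel_right]⟩
    · intro i
      obtain ⟨c, hc⟩ := hWy i
      exact ⟨c⁻¹, by rw [hθy, hc, ← mul_assoc, ← map_mul, inv_mul_cancel, map_one, one_mul]⟩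
    · rintro a b u v ⟨c, hc⟩ ⟨d, hd⟩
      refine ⟨c * d * W.cocycle a b, ?_⟩
      rw [map_mul, hc, hd, unitScalar_mul_mul_unitScalar_mul, W.Y_mul, map_mul _ (c * d), mul_assoc]
    · rintro a u ⟨c, hc⟩
      obtain ⟨d, hd⟩ := W.Y_inv a
      refine ⟨c⁻¹ * d, ?_⟩
      rw [map_inv, hc, mul_inv_rev, hd, ← map_inv, ← unitScalar_mul_comm, map_mul, mul_assoc]
  have hcomm : ∀ i, Commute (Y a) (QuantumTorus.yUnit k Λ i) := by
    intro i
    obtain ⟨c, hc⟩ := hYy i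
    have h1 := hYY a (Pi.single i 1)
    rw [ha, map_one, one_mul, hc, ← mul_assoc, ← unitScalar_mul_comm, mul_assoc, mul_assoc] at h1
    exact mul_left_cancel h1
  have hcent : Subalgebra.centralizer k {(Y a : QuantumTorus k Λ)} = ⊤ := by
    refine QuantumTorus.subalgebra_eq_top _ (fun i => ?_) fun i => ?_ <;>
      rw [Subalgebra.mem_centralizer_iff] <;> rintro _ rfl
    · exact congrArg Units.val (hcomm i).eq
    · exact congrArg Units.val (hcomm i).inv_right.eq
  have hmem : ((Y a : QuantumTorus k Λ) - 1) ∈ Subring.center (QuantumTorus k Λ) := by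
    rw [Subring.mem_center_iff]
    intro g
    have hg : g ∈ Subalgebra.centralizer k {(Y a : QuantumTorus k Λ)} := hcent ▸ Algebra.mem_top
    rw [mul_sub, sub_mul, mul_one, one_mul,
      (Subalgebra.mem_centralizer_iff k).1 hg _ (Set.mem_singleton _)]
  obtain ⟨c, hc⟩ := hθY a
  have hθa : θ ((Y a : QuantumTorus k Λ) - 1) = (unitScalar k _ c * W.Y a : F.carrierˣ) - 1 := by
    rw [← hc, map_sub, map_one]
    rfl
  have hrange : ∀ z, θ z ∈ W.range := by
    suffices H : W.range.comap θ = ⊤ from fun z => by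
      have : z ∈ W.range.comap θ := H ▸ Algebra.mem_top
      exact this
    refine QuantumTorus.subalgebra_eq_top _ (fun i => ?_) fun i => ?_ <;>
      rw [Subalgebra.mem_comap] <;> obtain ⟨c, hc⟩ := hWy i
    · rw [hθ, ← inv_mul_eq_iff_eq_mul.2 hc, ← map_inv]
      exact W.range.mul_mem (WeylSystem.unitScalar_mem _ _) (W.Y_mem_range _)
    · have h1 : θ (QuantumTorus.yinv k Λ i) = ((F.yUnit i)⁻¹ : F.carrierˣ) := by
        rw [← hθy, ← map_inv]
        rfl
      have hi : (F.yUnit i)⁻¹ = (W.Y (Pi.single i 1))⁻¹ * unitScalar k _ c := by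
        rw [hc, mul_inv_rev, inv_mul_cancel_right]
      rw [h1, hi]
      exact W.range.mul_mem (W.Y_inv_mem_range _) (WeylSystem.unitScalar_mem _ _)
  have hne0 : (⟨_, hmem⟩ : Subring.center (QuantumTorus k Λ)) ≠ 0 := by
    intro h0
    have h1 : (Y a : QuantumTorus k Λ) - 1 = 0 := congrArg Subtype.val h0
    rw [h1, map_zero, eq_comm, sub_eq_zero] at hθa
    exact W.unitScalar_mul_Y_ne_one c hne (Units.ext hθa)
  obtain ⟨z, hz⟩ := (IsSimpleRing.isField_center (QuantumTorus k Λ)).mul_inv_cancel hne0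
  have hz' := congrArg (fun t => θ (Subtype.val t)) (((mul_comm _ _).trans hz))
  obtain ⟨f, hf⟩ := hrange z
  refine W.toAlg_mul_sub_one_ne c hne f ?_
  rw [← hθa, hf, ← map_mul]
  exact hz'.trans (map_one θ)

end FractionDivisionRing

end Fractions

theorem monomial_mem_of_isUnit {k R : Type*} [Field k] [Ring R] [Algebra k R] {n : ℕ}
    {Y : (Fin n → ℤ) → Rˣ}
    (hY : ∀ a b, ∃ c : kˣ, Y a * Y b = unitScalar k R c * Y (a + b)) (S : Subalgebra k R)
    {N : Matrix (Fin n) (Fin n) ℤ} (hN : IsUnit N) (hS : ∀ i, Y (N i) ∈ S.toSubmonoid.units)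
    (a : Fin n → ℤ) : Y a ∈ S.toSubmonoid.units := by
  set U := S.toSubmonoid.units
  have hc : ∀ c, unitScalar k R c ∈ U := fun c => by
    rw [Submonoid.mem_units_iff, ← map_inv]
    exact ⟨S.algebraMap_mem _, S.algebraMap_mem _⟩
  have hadd : ∀ a b, Y a ∈ U → Y b ∈ U → Y (a + b) ∈ U := fun a b ha hb => by
    obtain ⟨c, h⟩ := hY a b
    exact (U.mul_mem_cancel_left (hc c)).1 (h ▸ U.mul_mem ha hb)
  have hzero : Y 0 ∈ U := by
    obtain ⟨c, h⟩ := hY 0 0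
    rw [add_zero, mul_left_inj] at h
    exact h ▸ hc c
  have hneg : ∀ a, Y a ∈ U → Y (-a) ∈ U := fun a ha => by
    obtain ⟨c, h⟩ := hY (-a) a
    rw [neg_add_cancel] at h
    exact (U.mul_mem_cancel_right ha).1 (h ▸ U.mul_mem (hc c) hzero)
  obtain ⟨b, rfl⟩ := Matrix.vecMul_surjective_iff_isUnit.2 hN a
  refine Pi.int_induction (P := fun b => Y (Matrix.vecMul b N) ∈ U) ?_ (fun i => ?_) ?_ ?_ b
  · rwa [Matrix.zero_vecMul]
  · rw [Matrix.single_one_vecMul]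
    exact hS i
  · intro a b ha hb
    rw [Matrix.add_vecMul]
    exact hadd _ _ ha hb
  · intro a ha
    rw [Matrix.neg_vecMul]
    exact hneg _ ha

section Main

variable {k : Type u} [Field k] {n : ℕ} {Λ Λ' : Matrix (Fin n) (Fin n) k}

theorem QuantumTorus.nonempty_algEquiv_of_exponents (h : Λ.MulAntisymmetric)
    (h' : Λ'.MulAntisymmetric) [IsSimpleRing (QuantumTorus k Λ)] [Nontrivial (QuantumTorus k Λ')]
    {N : Matrix (Fin n) (Fin n) ℤ} (hN : IsUnit N)
    (hL : ∀ i j, h.units i j = bicharacter h'.units (N i) (N j)) :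
    Nonempty (QuantumTorus k Λ ≃ₐ[k] QuantumTorus k Λ') := by
  obtain ⟨Y, hmul, hYy, hYY, -⟩ := exists_commuting_monomials (k := k) (QuantumTorus.yUnit k Λ')
    h'.units (QuantumTorus.yUnit_mul_yUnit h')
  obtain ⟨φ, hφ⟩ := QuantumTorus.exists_lift (Λ := Λ) (fun i => Y (N i)) fun i j => by
    rw [← Units.val_mul, hYY, ← hL, Algebra.smul_def]
    rfl
  have hinj : Function.Injective φ := φ.toRingHom.injective
  have hU := monomial_mem_of_isUnit hmul φ.range hN fun i => by
    have h1 : (Y (N i) : QuantumTorus k Λ') * φ (yinv k Λ i) = 1 := by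
      rw [← hφ, ← map_mul, y_mul_yinv, map_one]
    exact Submonoid.mem_units_iff _ _ |>.2
      ⟨⟨_, hφ i⟩, ⟨_, (Units.inv_eq_of_mul_eq_one_right h1).symm⟩⟩
  have htop : φ.range = ⊤ := by
    have hy : ∀ i, yUnit k Λ' i ∈ φ.range.toSubmonoid.units := fun i => by
      obtain ⟨c, hc⟩ := hYy i
      rw [← inv_mul_eq_iff_eq_mul, ← map_inv] at hc
      rw [← hc]
      refine mul_mem (Submonoid.mem_units_iff _ _ |>.2 ?_) (hU _)
      rw [← map_inv]
      exact ⟨φ.range.algebraMap_mem _, φ.range.algebraMap_mem _⟩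
    exact subalgebra_eq_top _ (fun i => (Submonoid.mem_units_iff _ _ |>.1 (hy i)).1)
      fun i => (Submonoid.mem_units_iff _ _ |>.1 (hy i)).2
  exact ⟨AlgEquiv.ofBijective φ ⟨hinj, AlgHom.range_eq_top φ |>.1 htop⟩⟩

theorem MixedCrossedAlgebra.exists_lift_units {R : Type*} [Ring R] [Algebra k R]
    (h : Λ.MulAntisymmetric) (u : Fin n → Rˣ) (w : Fin n → R)
    (hu : ∀ i j, u i * u j = unitScalar k R (h.units i j) * (u j * u i))
    (hw : ∀ i j, w i * w j = w j * w i)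
    (huw : ∀ i j, (u j : R) * w i = (w i - if i = j then 1 else 0) * u j) :
    ∃ φ : MixedCrossedAlgebra k Λ n le_rfl →ₐ[k] R,
      (∀ i, φ (MixedCrossedAlgebra.y k Λ n le_rfl i) = u i) ∧
        ∀ i, φ (MixedCrossedAlgebra.w k Λ i) = w i := by
  have hinv : ∀ i j, ((u i)⁻¹ : Rˣ) * (u j : R) = (Λ i j)⁻¹ • ((u j : R) * ((u i)⁻¹ : Rˣ)) := by
    intro i j
    have h1 : (u i)⁻¹ * u j = unitScalar k R (h.units i j)⁻¹ * (u j * (u i)⁻¹) := by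
      rw [inv_mul_eq_iff_eq_mul, ← mul_assoc, ← unitScalar_mul_comm, mul_assoc, ← mul_assoc (u i),
        hu, mul_assoc, mul_inv_cancel_right, ← mul_assoc, ← map_mul, inv_mul_cancel, map_one,
        one_mul]
    rw [← Units.val_mul, h1, Algebra.smul_def, ← h.coe_units, ← Units.val_inv_eq_inv_val]
    rfl
  have hinv' : ∀ i j, ((u i)⁻¹ : Rˣ) * ((u j)⁻¹ : Rˣ) = Λ i j •
      (((u j)⁻¹ : Rˣ) * ((u i)⁻¹ : Rˣ) : R) := by
    intro i j
    have h1 : (u i)⁻¹ * (u j)⁻¹ = unitScalar k R (h.units i j) * ((u j)⁻¹ * (u i)⁻¹) := by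
      rw [← mul_inv_rev, ← mul_inv_rev, hu i j, unitScalar_mul_comm,
        mul_inv_rev (unitScalar k R _), inv_mul_cancel_right]
    rw [← Units.val_mul, h1, Algebra.smul_def]
    rfl
  have hwu : ∀ i j, i ≠ j → w i * (u j : R) = u j * w i := fun i j hij => by
    rw [huw, if_neg hij, sub_zero]
  obtain ⟨φ, hφy, hφx⟩ := MixedCrossedAlgebra.exists_lift (Λ := Λ) (fun i => (u i : R))
    (fun i => ((u i)⁻¹ : Rˣ) * w i)
    (fun i j => by
      rw [← Units.val_mul, hu, Algebra.smul_def]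
      rfl)
    (fun i => by
      have h1 := huw i i
      rw [if_pos rfl, sub_mul, one_mul, eq_sub_iff_add_eq] at h1
      rw [Units.mul_inv_cancel_left, mul_assoc, ← h1, mul_add, Units.inv_mul_cancel_left,
        Units.inv_mul])
    (fun i j hij => by
      rw [mul_assoc, hwu i j hij, ← mul_assoc, hinv, smul_mul_assoc, mul_assoc])
    (fun i j => by
      rcases eq_or_ne i j with rfl | hij
      · rw [h.1, one_smul]
      have h1 : ∀ i j, i ≠ j → w i * ((u j)⁻¹ : Rˣ) = ((u j)⁻¹ : Rˣ) * w i := fun i j hij =>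
        ((show Commute (w i) (u j) from hwu i j hij).units_inv_right).eq
      rw [mul_assoc, ← mul_assoc (w i), h1 i j hij, mul_assoc (_ : R) (w j), ← mul_assoc (w j),
        h1 j i hij.symm, mul_assoc _ (w i), mul_assoc _ (w j), hw, ← mul_assoc, ← mul_assoc, hinv']
      simp only [smul_mul_assoc, mul_assoc])
  refine ⟨φ, hφy, fun i => ?_⟩
  rw [MixedCrossedAlgebra.w, map_mul, hφy, hφx, Units.mul_inv_cancel_left]

namespace FractionDivisionRing

theorem exists_exponents_of_algHom [CharZero k]
    (F : FractionDivisionRing k (MixedCrossedAlgebra k Λ n le_rfl)) (h : Λ.MulAntisymmetric)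
    (h' : Λ'.MulAntisymmetric) (g : QuantumTorus k Λ' →ₐ[k] F.carrier) :
    ∃ M : Matrix (Fin n) (Fin n) ℤ, ∀ i j, h'.units i j = bicharacter h.units (M i) (M j) := by
  refine F.exists_exponents h
    (fun i => Units.map (g : QuantumTorus k Λ' →* F.carrier) (QuantumTorus.yUnit k Λ' i))
    fun i j => ?_
  have hg : Units.map (g : QuantumTorus k Λ' →* F.carrier) (unitScalar k _ (h'.units i j)) =
      unitScalar k _ (h'.units i j) := Units.ext (g.commutes _)
  rw [← map_mul, QuantumTorus.yUnit_mul_yUnit h', map_mul, map_mul, hg]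

theorem nonempty_algEquiv_of_exponents [CharZero k]
    (F : FractionDivisionRing k (MixedCrossedAlgebra k Λ n le_rfl))
    (F' : FractionDivisionRing k (MixedCrossedAlgebra k Λ' n le_rfl))
    (h : Λ.MulAntisymmetric) (h' : Λ'.MulAntisymmetric) {M : Matrix (Fin n) (Fin n) ℤ}
    (hM : IsUnit M) (hL : ∀ i j, h'.units i j = bicharacter h.units (M i) (M j)) :
    Nonempty (F'.carrier ≃ₐ[k] F.carrier) := by
  obtain ⟨W, hWw, hWy, hYY, -⟩ := MixedCrossedAlgebra.exists_weylSystem h F.emb F.yUnit fun i => rfl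
  obtain ⟨B, hMB, hBM⟩ := isUnit_iff_exists.1 hM
  let p : Fin n → MvPolynomial (Fin n) k := fun i =>
    ∑ l, (B l i : k) • MvPolynomial.X l
  have hshift : ∀ i j, intShift k (M j) (p i) = p i - if i = j then 1 else 0 := fun i j => by
    have h1 := congrFun (congrFun hMB j) i
    rw [Matrix.mul_apply, Matrix.one_apply] at h1
    simp only [p, map_sum, map_smul, intShift_X, smul_sub, Finset.sum_sub_distrib]
    congr 1
    rw [if_congr (eq_comm (a := i)) rfl rfl]
    have h2 := congrArg (fun z : ℤ => (MvPolynomial.C (z : k) : MvPolynomial (Fin n) k)) h1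
    refine Eq.trans ?_ (h2.trans ?_)
    · push_cast
      rw [map_sum]
      refine Finset.sum_congr rfl fun l _ => ?_
      rw [MvPolynomial.smul_eq_C_mul, ← map_mul, mul_comm]
    · split_ifs <;> simp
  have hX : ∀ l, ∑ i, (M i l : k) • p i = MvPolynomial.X l := fun l => by
    simp only [p, Finset.smul_sum, smul_smul]
    rw [Finset.sum_comm]
    simp only [← Finset.sum_smul]
    rw [Finset.sum_eq_single l]
    · have h1 := congrArg (Int.cast (R := k)) (congrFun (congrFun hBM l) l)
      rw [Matrix.mul_apply, Matrix.one_apply_eq] at h1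
      push_cast at h1
      simp only [mul_comm (M _ _ : k), h1, one_smul]
    · intro m _ hm
      have h1 := congrArg (Int.cast (R := k)) (congrFun (congrFun hBM m) l)
      rw [Matrix.mul_apply, Matrix.one_apply_ne hm] at h1
      push_cast at h1
      simp only [mul_comm (M _ _ : k), h1, zero_smul]
    · simp
  obtain ⟨φ, hφy, hφw⟩ := MixedCrossedAlgebra.exists_lift_units h' (fun i => W.Y (M i))
    (fun i => W.ev (p i)) (fun i j => by rw [hYY, hL])
    (fun i j => by rw [← map_mul, mul_comm, map_mul])
    (fun i j => by
      rw [W.Y_mul_ev, hshift, map_sub]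
      split_ifs <;> simp)
  obtain ⟨ψ, hψ⟩ := F'.exists_algHom φ (F'.injective_of_units h' φ _ hφy)
  have hinv : ∀ z ∈ ψ.range, z⁻¹ ∈ ψ.range := by
    rintro _ ⟨a, rfl⟩
    exact ⟨a⁻¹, map_inv₀ ψ a⟩
  have hφψ : ∀ s, φ s ∈ ψ.range := fun s => ⟨F'.emb s, hψ s⟩
  have hunit : ∀ v : F.carrierˣ, (v : F.carrier) ∈ ψ.range → v ∈ ψ.range.toSubmonoid.units :=
    fun v hv => (Submonoid.mem_units_iff _ _).2
      ⟨hv, by rw [Units.val_inv_eq_inv_val]; exact hinv _ hv⟩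
  have hY := monomial_mem_of_isUnit (fun a b => ⟨_, W.Y_mul a b⟩) ψ.range hM fun i =>
    hunit _ (hφy i ▸ hφψ _)
  have hy : ∀ i, F.emb (MixedCrossedAlgebra.y k Λ n le_rfl i) ∈ ψ.range := fun i => by
    obtain ⟨c, hc⟩ := hWy i
    rw [← F.coe_yUnit, ← inv_mul_eq_iff_eq_mul.2 hc, ← map_inv]
    exact mul_mem (WeylSystem.unitScalar_mem _ _) ((Submonoid.mem_units_iff _ _).1 (hY _)).1
  have hw : ∀ i, F.emb (MixedCrossedAlgebra.w k Λ i) ∈ ψ.range := fun i => by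
    rw [← hWw, ← hX, map_sum]
    refine sum_mem fun l _ => ?_
    rw [map_smul, ← hφw]
    exact ψ.range.smul_mem (hφψ _) _
  have hx : ∀ i, F.emb (MixedCrossedAlgebra.x k Λ n le_rfl i) ∈ ψ.range := fun i => by
    have h1 := mul_mem (hinv _ (hy i)) (hw i)
    rwa [MixedCrossedAlgebra.w, map_mul, inv_mul_cancel_left₀ (F.emb_y_ne_zero i)] at h1
  have htop : ψ.range.comap F.emb = ⊤ := MixedCrossedAlgebra.subalgebra_eq_top _ hy hx
  have hemb : ∀ s, F.emb s ∈ ψ.range := fun s => by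
    have : s ∈ ψ.range.comap F.emb := htop ▸ Algebra.mem_top
    exact this
  refine ⟨AlgEquiv.ofBijective ψ ⟨ψ.toRingHom.injective, fun d => ?_⟩⟩
  obtain ⟨a, b, -, rfl⟩ := F.frac d
  exact mul_mem (hemb a) (hinv _ (hemb b))

end FractionDivisionRing

end Main

/-- (Semi-classical case.) Assume `O_Λ((k*)^n)` is simple. Division rings
of fractions of `S_{n,n}^Λ(k)` and `S_{n,n}^{Λ'}(k)` are `k`-isomorphic iff the quantum
tori `O_Λ((k*)^n)` and `O_{Λ'}((k*)^n)` are `k`-isomorphic. -/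
theorem stmt18 {k : Type u} [Field k] [CharZero k] {n : ℕ} (hn : 1 ≤ n)
    (Λ Λ' : Matrix (Fin n) (Fin n) k) (hΛ : Λ.MulAntisymmetric) (hΛ' : Λ'.MulAntisymmetric)
    (hsimple : IsSimpleRing (QuantumTorus k Λ))
    (F : FractionDivisionRing k (MixedCrossedAlgebra k Λ n le_rfl))
    (F' : FractionDivisionRing k (MixedCrossedAlgebra k Λ' n le_rfl)) :
    Nonempty (F.carrier ≃ₐ[k] F'.carrier) ↔
      Nonempty (QuantumTorus k Λ ≃ₐ[k] QuantumTorus k Λ') := by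
  obtain ⟨θ, -⟩ := F.exists_torusHom
  obtain ⟨θ', -⟩ := F'.exists_torusHom
  constructor
  · rintro ⟨e⟩
    obtain ⟨M, hM⟩ := F.exists_exponents_of_algHom hΛ hΛ' ((e.symm : _ →ₐ[k] _).comp θ')
    obtain ⟨N, hN⟩ := F'.exists_exponents_of_algHom hΛ' hΛ ((e : _ →ₐ[k] _).comp θ)
    have : Nontrivial (QuantumTorus k Λ') := θ'.toRingHom.domain_nontrivial
    exact QuantumTorus.nonempty_algEquiv_of_exponents hΛ hΛ'
      (isUnit_of_bicharacter_pullback (F.bicharacter_nondegenerate hΛ) hM hN).2 hN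
  · rintro ⟨e⟩
    obtain ⟨M, hM⟩ := F.exists_exponents_of_algHom hΛ hΛ' (θ.comp (e.symm : _ →ₐ[k] _))
    obtain ⟨N, hN⟩ := F'.exists_exponents_of_algHom hΛ' hΛ (θ'.comp (e : _ →ₐ[k] _))
    obtain ⟨e'⟩ := F.nonempty_algEquiv_of_exponents F' hΛ hΛ'
      (isUnit_of_bicharacter_pullback (F.bicharacter_nondegenerate hΛ) hM hN).1 hM
    exact ⟨e'.symm⟩
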